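/- arXiv:1809.08299 — 11 statements merged into one kernel-verified Lean document; each statement's English description precedes it below -/
import Mathlib

section
/- Hereditary condition: Let M be a B-model over any signature, let α and β be worlds with Rsαβ, let A be any formula and ā an assignment of domain elements to its free variables. If M,α ⊨ A[ā] then M,β ⊨ A[ā]. -/
namespace RM

/-- A first-order signature: function symbols with arities and
relation symbols with arities. -/
structure Signature where
  Func : Type
  farity : Func → ℕ
  Rel : Type
  rarity : Rel → ℕ

variable {σ : Signature}

/-- Terms over a signature, with variables indexed by `ℕ`. -/
inductive Term (σ : Signature) : Type where
  | var : ℕ → Term σ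
  | func : (f : σ.Func) → (Fin (σ.farity f) → Term σ) → Term σ

/-- Formulas of the quantificational relevant language:
`⊥`, `⊤`, (logical) equality, atomic relations, `∧`, `∨`, `¬`, `→`, `∀`, `∃`. -/
inductive Formula (σ : Signature) : Type where
  | falsum : Formula σ
  | verum : Formula σ
  | equal : Term σ → Term σ → Formula σ
  | rel : (r : σ.Rel) → (Fin (σ.rarity r) → Term σ) → Formula σ
  | and : Formula σ → Formula σ → Formula σ
  | or : Formula σ → Formula σ → Formula σ
  | neg : Formula σ → Formula σ
  | imp : Formula σ → Formula σ → Formula σ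
  | all : ℕ → Formula σ → Formula σ
  | ex : ℕ → Formula σ → Formula σ

/-- The relevant biconditional `A ↔ B := (A → B) ∧ (B → A)`. -/
def Formula.iff (A B : Formula σ) : Formula σ := .and (.imp A B) (.imp B A)

/-- Free variables of a term. -/
def Term.fv : Term σ → Set ℕ
  | .var n => {n}
  | .func _ ts => ⋃ i, (ts i).fv

/-- Free variables of a formula. -/
def Formula.fv : Formula σ → Set ℕ
  | .falsum => ∅
  | .verum => ∅
  | .equal t u => t.fv ∪ u.fv
  | .rel _ ts => ⋃ i, (ts i).fv
  | .and A B => A.fv ∪ B.fv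
  | .or A B => A.fv ∪ B.fv
  | .imp A B => A.fv ∪ B.fv
  | .neg A => A.fv
  | .all x A => A.fv \ {x}
  | .ex x A => A.fv \ {x}

/-- Quantifier-free formulas. -/
def Formula.QFree : Formula σ → Prop
  | .falsum => True
  | .verum => True
  | .equal _ _ => True
  | .rel _ _ => True
  | .and A B => A.QFree ∧ B.QFree
  | .or A B => A.QFree ∧ B.QFree
  | .imp A B => A.QFree ∧ B.QFree
  | .neg A => A.QFree
  | .all _ _ => False
  | .ex _ _ => False

/-- A sentence is a formula with no free variables. -/
def Formula.Sentence (A : Formula σ) : Prop := A.fv = ∅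

/-- A `B`-model (Routley–Meyer model for the basic relevant logic **B**):
worlds `W`, ternary relation `R`, domain `D`, Routley star `*`,
designated world `s`, world-independent interpretation of function symbols,
world-relative valuation `V` of relation symbols, subject to the usual
conditions; the logical equality symbol is always interpreted as real identity. -/
structure BModel (σ : Signature) where
  W : Type
  R : W → W → W → Prop
  D : Type
  dne : Nonempty D
  star : W → W
  s : W
  interpFunc : (f : σ.Func) → (Fin (σ.farity f) → D) → D
  V : W → (r : σ.Rel) → (Fin (σ.rarity r) → D) → Prop
  base : ∀ α, R s α α
  btrans : ∀ α β γ δ, R s α β → R β γ δ → R α γ δ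
  star_star : ∀ α, star (star α) = α
  star_anti : ∀ α β, R s α β → R s (star β) (star α)
  hered : ∀ α β, R s α β → ∀ r v, V α r v → V β r v

namespace BModel

variable (M : BModel σ)

/-- Evaluation of a term under an assignment. -/
def evalT (a : ℕ → M.D) : Term σ → M.D
  | .var n => a n
  | .func f ts => M.interpFunc f fun i => evalT a (ts i)

/-- Truth of a formula at a world, under an assignment of domain
elements to variables (Routley–Meyer truth conditions). -/
def Truth : M.W → (ℕ → M.D) → Formula σ → Prop
  | _, _, .falsum => False
  | _, _, .verum => True
  | _, a, .equal t u => M.evalT a t = M.evalT a u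
  | w, a, .rel r ts => M.V w r fun i => M.evalT a (ts i)
  | w, a, .and A B => Truth w a A ∧ Truth w a B
  | w, a, .or A B => Truth w a A ∨ Truth w a B
  | w, a, .neg A => ¬ Truth (M.star w) a A
  | w, a, .imp A B => ∀ w₁ w₂, M.R w w₁ w₂ → Truth w₁ a A → Truth w₂ a B
  | w, a, .all x A => ∀ d : M.D, Truth w (Function.update a x d) A
  | w, a, .ex x A => ∃ d : M.D, Truth w (Function.update a x d) A

/-- `M` satisfies `A` (at the designated world, under every assignment). -/
def SatAx (A : Formula σ) : Prop := ∀ a : ℕ → M.D, M.Truth M.s a A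

/-- `M` satisfies the theory `T` at its designated world. -/
def SatTheory (T : Set (Formula σ)) : Prop := ∀ A ∈ T, M.SatAx A

/-- Seriality: every world sees some pair via `R`. -/
def Serial : Prop := ∀ x : M.W, ∃ y z, M.R x y z

/-- The frame condition corresponding to the axiom `K`: `Rαβγ → Rsαγ`. -/
def Kcond : Prop := ∀ α β γ, M.R α β γ → M.R M.s α γ

/-- The additional frame conditions making a `B`-model an `RM`-model. -/
def IsRM : Prop :=
  (∀ α β γ, M.R α β γ → M.R α (M.star γ) (M.star β)) ∧
  (∀ α β γ, M.R α β γ → M.R α γ β) ∧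
  (∀ α, M.R α α α) ∧
  (∀ α β γ δ, (∃ x, M.R α β x ∧ M.R x γ δ) → ∃ y, M.R α y δ ∧ M.R β γ y) ∧
  (∀ α β γ, M.R α β γ → M.R M.s α γ ∨ M.R M.s β γ)

end BModel

/-- Semantic entailment over a class `C` of `B`-models: every model in `C`
whose designated world satisfies all of `T` also satisfies `A` at its
designated world. -/
def Entails (C : BModel σ → Prop) (T : Set (Formula σ)) (A : Formula σ) : Prop :=
  ∀ M : BModel σ, C M → M.SatTheory T → M.SatAx A

end RM


open RM


/-- **Hereditary condition.** In any `B`-model, if `R s α β` then every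
formula true at `α` (under any assignment) is true at `β`. -/
theorem stmt_0 {σ : Signature} (M : BModel σ) (α β : M.W) (h : M.R M.s α β)
    (A : Formula σ) (a : ℕ → M.D) (hA : M.Truth α a A) : M.Truth β a A := by
  induction A generalizing α β a with
  | falsum => exact hA
  | verum => exact hA
  | equal t u =>
    simp only [BModel.Truth] at hA ⊢
    exact hA
  | rel r ts =>
    simp only [BModel.Truth] at hA ⊢
    exact M.hered α β h r _ hA
  | and A B ihA ihB =>
    simp only [BModel.Truth] at hA ⊢
    exact ⟨ihA α β h a hA.1, ihB α β h a hA.2⟩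
  | or A B ihA ihB =>
    simp only [BModel.Truth] at hA ⊢
    exact hA.imp (ihA α β h a) (ihB α β h a)
  | neg A ih =>
    simp only [BModel.Truth] at hA ⊢
    exact fun hβ => hA (ih _ _ (M.star_anti α β h) a hβ)
  | imp A B _ _ =>
    simp only [BModel.Truth] at hA ⊢
    exact fun w₁ w₂ hR => hA w₁ w₂ (M.btrans α β w₁ w₂ h hR)
  | all x A ih =>
    simp only [BModel.Truth] at hA ⊢
    exact fun d => ih α β h _ (hA d)
  | ex x A ih =>
    simp only [BModel.Truth] at hA ⊢
    exact hA.imp fun d => ih α β h _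
end

section
/- Let M be a B-model over any signature, A and B formulas, and ā an assignment. Then M,s ⊨ (A→B)[ā] if and only if for every world α, M,α ⊨ A[ā] implies M,α ⊨ B[ā]. -/
open RM


/-- Truth is hereditary along the order `R s` on worlds. -/
theorem RM.BModel.Truth.mono {σ : Signature} (M : BModel σ) {α β : M.W} {a : ℕ → M.D}
    {A : Formula σ} (h : M.R M.s α β) (hA : M.Truth α a A) : M.Truth β a A := by
  induction A generalizing α β a with
  | falsum => exact hA
  | verum => trivial
  | equal t u => exact hA
  | rel r ts => exact M.hered α β h r _ hA
  | and A B ihA ihB => exact ⟨ihA h hA.1, ihB h hA.2⟩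
  | or A B ihA ihB => exact Or.imp (ihA h) (ihB h) hA
  | neg A ih => exact fun hβ => hA (ih (M.star_anti α β h) hβ)
  | imp A B _ _ => exact fun γ δ hR => hA γ δ (M.btrans α β γ δ h hR)
  | all x A ih => exact fun d => ih h (hA d)
  | ex x A ih => exact Exists.imp (fun _ => ih h) hA

/-- In any `B`-model, `A → B` holds at the designated world `s` iff at every
world, `A` implies `B`. -/
theorem stmt_1 {σ : Signature} (M : BModel σ) (A B : Formula σ) (a : ℕ → M.D) :
    M.Truth M.s a (.imp A B) ↔ ∀ α : M.W, M.Truth α a A → M.Truth α a B := by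
  exact ⟨fun h α => h α α (M.base α),
    fun h α _ hR hA => BModel.Truth.mono M hR (h α hA)⟩
end

section
/- DLO has no finite models: every B-model whose designated world s satisfies the DLO axioms A1, A3 and A5 (equivalently, all of DLO) has an infinite domain D. -/
open RM

/-- The signature of DLO: no function symbols, one binary relation `<`. -/
def dloSig : Signature := ⟨Empty, fun e => e.elim, Unit, fun _ => 2⟩

namespace DLO

/-- Variable `n` as a term of the language of DLO. -/
def v (n : ℕ) : Term dloSig := .var n

/-- The atomic formula `t < u`. -/
def lt (t u : Term dloSig) : Formula dloSig := .rel () ![t, u]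

/-- A1: `∀x(x<x → ⊥)`. -/
def ax1 : Formula dloSig := .all 0 (.imp (lt (v 0) (v 0)) .falsum)
/-- A2: `∀x,y(x=y ∨ x<y ∨ y<x)`. -/
def ax2 : Formula dloSig :=
  .all 0 (.all 1 (.or (.equal (v 0) (v 1)) (.or (lt (v 0) (v 1)) (lt (v 1) (v 0)))))
/-- A3: `∀x,y,z((x<y ∧ y<z) → x<z)`. -/
def ax3 : Formula dloSig :=
  .all 0 (.all 1 (.all 2 (.imp (.and (lt (v 0) (v 1)) (lt (v 1) (v 2))) (lt (v 0) (v 2)))))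
/-- A4: `∀x,y(x<y → ∃z(x<z ∧ z<y))`. -/
def ax4 : Formula dloSig :=
  .all 0 (.all 1 (.imp (lt (v 0) (v 1)) (.ex 2 (.and (lt (v 0) (v 2)) (lt (v 2) (v 1))))))
/-- A5: `∀x∃y(x<y)`. -/
def ax5 : Formula dloSig := .all 0 (.ex 1 (lt (v 0) (v 1)))
/-- A6: `∀x∃y(y<x)`. -/
def ax6 : Formula dloSig := .all 0 (.ex 1 (lt (v 1) (v 0)))

/-- The theory DLO of dense linear orders without endpoints. -/
def theory : Set (Formula dloSig) := {ax1, ax2, ax3, ax4, ax5, ax6}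

end DLO


namespace DLO

/-- The binary relation on the domain interpreting `<` at the world `w`. -/
def ltAt (M : BModel dloSig) (w : M.W) (x y : M.D) : Prop := M.V w () ![x, y]

theorem truth_lt_iff (M : BModel dloSig) (w : M.W) (a : ℕ → M.D) (m n : ℕ) :
    M.Truth w a (lt (v m) (v n)) ↔ ltAt M w (a m) (a n) := by
  have hv : (fun i : Fin 2 => M.evalT a ((![v m, v n] : Fin 2 → Term dloSig) i))
      = ![a m, a n] := by
    funext i
    fin_cases i <;> rfl
  exact iff_of_eq (congrArg (M.V w ()) hv)

theorem ltAt_irrefl (M : BModel dloSig) (h : M.SatAx ax1) (x : M.D) : ¬ ltAt M M.s x x := by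
  intro hx
  obtain ⟨x₀⟩ := M.dne
  exact h (fun _ => x₀) x M.s M.s (M.base M.s) ((truth_lt_iff M _ _ 0 0).2 (by simpa using hx))

theorem ltAt_trans (M : BModel dloSig) (h : M.SatAx ax3) {x y z : M.D}
    (hxy : ltAt M M.s x y) (hyz : ltAt M M.s y z) : ltAt M M.s x z := by
  obtain ⟨x₀⟩ := M.dne
  have key := h (fun _ => x₀) x y z M.s M.s (M.base M.s)
    ⟨(truth_lt_iff M _ _ 0 1).2 (by simpa [Function.update] using hxy),
      (truth_lt_iff M _ _ 1 2).2 (by simpa [Function.update] using hyz)⟩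
  simpa [Function.update] using (truth_lt_iff M _ _ 0 2).1 key

theorem exists_ltAt (M : BModel dloSig) (h : M.SatAx ax5) (x : M.D) : ∃ y, ltAt M M.s x y := by
  obtain ⟨x₀⟩ := M.dne
  obtain ⟨y, hy⟩ := h (fun _ => x₀) x
  exact ⟨y, by simpa [Function.update] using (truth_lt_iff M _ _ 0 1).1 hy⟩

end DLO

/-- DLO has no finite models: any `B`-model whose designated world satisfies
the DLO axioms A1, A3 and A5 (a fortiori, all of DLO) has an infinite domain. -/
theorem stmt_2 (M : BModel dloSig)
    (h : M.SatTheory {DLO.ax1, DLO.ax3, DLO.ax5}) : Infinite M.D := by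
  have := M.dne
  let : Preorder M.D :=
    { le := fun x y => x = y ∨ DLO.ltAt M M.s x y
      lt := DLO.ltAt M M.s
      le_refl := fun x => Or.inl rfl
      le_trans := by
        rintro x y z (rfl | hxy) (rfl | hyz)
        · exact Or.inl rfl
        · exact Or.inr hyz
        · exact Or.inr hxy
        · exact Or.inr (DLO.ltAt_trans M (h _ (by simp)) hxy hyz)
      lt_iff_le_not_ge := by
        intro x y
        have irrefl := DLO.ltAt_irrefl M (h _ (by simp))
        constructor
        · intro hxy
          refine ⟨Or.inr hxy, ?_⟩
          rintro (rfl | hyx)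
          · exact irrefl _ hxy
          · exact irrefl _ (DLO.ltAt_trans M (h _ (by simp)) hxy hyx)
        · rintro ⟨rfl | hxy, hyx⟩
          · exact absurd (Or.inl rfl) hyx
          · exact hxy }
  have : NoMaxOrder M.D := ⟨DLO.exists_ltAt M (h _ (by simp))⟩
  exact NoMaxOrder.infinite
end

section
/- Let C be any class of B-models over the signature of DLO each of which satisfies seriality. Then for every quantifier-free formula A(x) with exactly one free variable x, either DLO ⊨_C A(x)↔(x=x) or DLO ⊨_C A(x)↔(x<x). -/
open RM

namespace DLO

/-- A term of the language of DLO whose only variable is `0` denotes the value of that variable. -/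
theorem evalT_eq_of_fv_subset (M : BModel dloSig) (a : ℕ → M.D) (t : Term dloSig)
    (ht : t.fv ⊆ {0}) : M.evalT a t = a 0 := by
  cases t with
  | var n =>
    have hn : n = 0 := ht rfl
    rw [hn]
    rfl
  | func f _ => exact f.elim

/-- In a model of DLO, `x < x` is true at no world. -/
theorem not_truth_lt_self (M : BModel dloSig) (hM : M.SatTheory theory) (w : M.W)
    (a : ℕ → M.D) : ¬ M.Truth w a (lt (v 0) (v 0)) := by
  intro h
  have h₁ := hM ax1 (Or.inl rfl) a (a 0) w w (M.base w)
  rw [Function.update_eq_self] at h₁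
  exact h₁ h

/-- A quantifier-free formula in the variable `0` alone has a truth value that depends neither on
the serial model of DLO, nor on the world, nor on the assignment. -/
theorem truth_const (A : Formula dloSig) (hq : A.QFree) (hfv : A.fv ⊆ {0}) :
    ∃ p : Prop, ∀ M : BModel dloSig, M.Serial → M.SatTheory theory →
      ∀ w a, M.Truth w a A ↔ p := by
  induction A with
  | falsum => exact ⟨False, fun _ _ _ _ _ => Iff.rfl⟩
  | verum => exact ⟨True, fun _ _ _ _ _ => Iff.rfl⟩
  | equal t u =>
    obtain ⟨ht, hu⟩ := Set.union_subset_iff.1 hfv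
    refine ⟨True, fun M _ _ w a => iff_true_intro ?_⟩
    exact (evalT_eq_of_fv_subset M a t ht).trans (evalT_eq_of_fv_subset M a u hu).symm
  | rel r ts =>
    refine ⟨False, fun M _ hM w a => iff_false_intro fun h => not_truth_lt_self M hM w a ?_⟩
    have e : (fun i => M.evalT a (ts i)) = fun i : Fin 2 => M.evalT a (![v 0, v 0] i) := by
      funext i
      rw [evalT_eq_of_fv_subset M a (ts i) (Set.iUnion_subset_iff.1 hfv i)]
      fin_cases i <;> rfl
    exact (congrArg (M.V w ()) e).mp h
  | and A B ihA ihB =>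
    obtain ⟨hA, hB⟩ := Set.union_subset_iff.1 hfv
    obtain ⟨p, hp⟩ := ihA hq.1 hA
    obtain ⟨q, hq⟩ := ihB hq.2 hB
    exact ⟨p ∧ q, fun M hS hM w a => and_congr (hp M hS hM w a) (hq M hS hM w a)⟩
  | or A B ihA ihB =>
    obtain ⟨hA, hB⟩ := Set.union_subset_iff.1 hfv
    obtain ⟨p, hp⟩ := ihA hq.1 hA
    obtain ⟨q, hq⟩ := ihB hq.2 hB
    exact ⟨p ∨ q, fun M hS hM w a => or_congr (hp M hS hM w a) (hq M hS hM w a)⟩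
  | neg A ih =>
    obtain ⟨p, hp⟩ := ih hq hfv
    exact ⟨¬ p, fun M hS hM w a => not_congr (hp M hS hM (M.star w) a)⟩
  | imp A B ihA ihB =>
    obtain ⟨hA, hB⟩ := Set.union_subset_iff.1 hfv
    obtain ⟨p, hp⟩ := ihA hq.1 hA
    obtain ⟨q, hq⟩ := ihB hq.2 hB
    refine ⟨p → q, fun M hS hM w a => ⟨fun h hpt => ?_, fun h w₁ w₂ _ h₁ => ?_⟩⟩
    · obtain ⟨y, z, hyz⟩ := hS w
      exact (hq M hS hM z a).1 (h y z hyz ((hp M hS hM y a).2 hpt))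
    · exact (hq M hS hM w₂ a).2 (h ((hp M hS hM w₁ a).1 h₁))
  | all _ _ _ => exact hq.elim
  | ex _ _ _ => exact hq.elim

end DLO

/-- Over any class of serial `B`-models, every quantifier-free formula in the
single free variable `x` (the variable `0`) is DLO-equivalent to `x = x` or
to `x < x`. -/
theorem stmt_3 (C : BModel dloSig → Prop) (hC : ∀ M : BModel dloSig, C M → M.Serial)
    (A : Formula dloSig) (hq : A.QFree) (hfv : A.fv = {0}) :
    Entails C DLO.theory (A.iff (.equal (DLO.v 0) (DLO.v 0))) ∨
    Entails C DLO.theory (A.iff (DLO.lt (DLO.v 0) (DLO.v 0))) := by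
  obtain ⟨p, hp⟩ := DLO.truth_const A hq hfv.subset
  by_cases h : p
  · refine Or.inl fun M hM hT a => ⟨fun _ _ _ _ => rfl, fun _ w _ _ => ?_⟩
    exact (hp M (hC M hM) hT w a).2 h
  · refine Or.inr fun M hM hT a => ⟨fun w _ _ hA => ?_, fun w _ _ hL => ?_⟩
    · exact (h ((hp M (hC M hM) hT _ a).1 hA)).elim
    · exact (DLO.not_truth_lt_self M hT _ a hL).elim
end

section
/- Failure of quantifier elimination for DLO in any relevant logic between B and RM: let C be any class of B-models over the signature of DLO that contains every RM-model. Then there is a formula with one free variable y, namely ¬∃x(x<y) ∧ (∀x(x=x)→∃x(y<x)), for which there is no quantifier-free formula B(y) with DLO ⊨_C (¬∃x(x<y) ∧ (∀x(x=x)→∃x(y<x))) ↔ B(y). Hence DLO does not admit quantifier elimination over C. -/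
open RM

/-- The formula `¬∃x(x<y) ∧ (∀x(x=x) → ∃x(y<x))`, where `y` is the variable
`1` and `x` is the variable `0`. -/
def phi : Formula dloSig :=
  .and (.neg (.ex 0 (DLO.lt (DLO.v 0) (DLO.v 1))))
    (.imp (.all 0 (.equal (DLO.v 0) (DLO.v 0))) (.ex 0 (DLO.lt (DLO.v 1) (DLO.v 0))))


/-- An RM-model of DLO with two worlds, each its own Routley star, over the domain `ℚ`. The
designated world `true` carries the usual order and sees both worlds; `false` sees only itself, and
its order is the usual one restricted to pairs whose first entry is nonnegative, so that `0` is
minimal there. -/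
def halfLineModel : BModel dloSig where
  W := Bool
  R α β γ := β = γ ∧ (α = true ∨ β = false)
  D := ℚ
  dne := ⟨0⟩
  star α := α
  s := true
  interpFunc f := f.elim
  V w _ x := x (0 : Fin 2) < x (1 : Fin 2) ∧ (w = true ∨ 0 ≤ x (0 : Fin 2))
  base _ := ⟨rfl, .inl rfl⟩
  btrans := by
    rintro α β γ δ ⟨rfl, -⟩ h
    exact h
  star_star _ := rfl
  star_anti := by
    rintro α β ⟨rfl, -⟩
    exact ⟨rfl, .inl rfl⟩
  hered := by
    rintro α β ⟨rfl, -⟩ r v h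
    exact h

namespace halfLineModel

theorem isRM : halfLineModel.IsRM := by
  refine ⟨?_, ?_, ?_, ?_, ?_⟩
  · rintro α β γ ⟨rfl, h⟩
    exact ⟨rfl, h⟩
  · rintro α β γ ⟨rfl, h⟩
    exact ⟨rfl, h⟩
  · intro α
    exact ⟨rfl, (Bool.eq_false_or_eq_true α)⟩
  · rintro α β γ δ ⟨x, ⟨rfl, h⟩, rfl, h'⟩
    refine ⟨γ, ⟨rfl, ?_⟩, rfl, h'⟩
    rcases h with h | rfl
    · exact .inl h
    · exact .inr (h'.resolve_left Bool.false_ne_true)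
  · rintro α β γ ⟨rfl, -⟩
    exact .inr ⟨rfl, .inl rfl⟩

theorem truth_lt (w : Bool) (a : ℕ → ℚ) (m n : ℕ) :
    halfLineModel.Truth w a (DLO.lt (DLO.v m) (DLO.v n)) ↔ a m < a n ∧ (w = true ∨ 0 ≤ a m) :=
  Iff.rfl

theorem satTheory : halfLineModel.SatTheory DLO.theory := by
  rintro A (rfl | rfl | rfl | rfl | rfl | rfl) a
  · rintro x w _ ⟨rfl, -⟩ h
    exact lt_irrefl _ ((truth_lt _ _ _ _).1 h).1
  · intro (x : ℚ) (y : ℚ)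
    rcases lt_trichotomy x y with h | h | h
    · exact .inr (.inl ⟨h, .inl rfl⟩)
    · exact .inl h
    · exact .inr (.inr ⟨h, .inl rfl⟩)
  · rintro x y z w _ ⟨rfl, -⟩ ⟨h, h'⟩
    exact ⟨lt_trans h.1 h'.1, h.2⟩
  · rintro (x : ℚ) (y : ℚ) w _ ⟨rfl, -⟩ ⟨(h : x < y), h'⟩
    obtain ⟨z, hxz, hzy⟩ := exists_between h
    exact ⟨z, ⟨hxz, h'⟩, hzy, h'.imp_right fun h0 => le_trans h0 hxz.le⟩
  · intro (x : ℚ)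
    obtain ⟨y, hy⟩ := exists_gt x
    exact ⟨y, hy, .inl rfl⟩
  · intro (x : ℚ)
    obtain ⟨y, hy⟩ := exists_lt x
    exact ⟨y, hy, .inl rfl⟩

theorem term_eq_var_one {t : Term dloSig} (h : t.fv ⊆ {1}) : t = .var 1 := by
  cases t with
  | var n => exact congrArg _ (h rfl)
  | func f ts => exact f.elim

/-- A quantifier-free formula in a single variable has a constant truth value. -/
theorem truth_iff_of_qFree {B : Formula dloSig} (hB : B.QFree) (hv : B.fv ⊆ {1})
    (w w' : Bool) (a a' : ℕ → ℚ) :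
    halfLineModel.Truth w a B ↔ halfLineModel.Truth w' a' B := by
  induction B generalizing w w' a a' with
  | falsum => exact Iff.rfl
  | verum => exact Iff.rfl
  | equal t u =>
    obtain ⟨ht, hu⟩ := Set.union_subset_iff.1 hv
    obtain rfl := term_eq_var_one ht
    obtain rfl := term_eq_var_one hu
    exact iff_of_true rfl rfl
  | rel r ts =>
    have hts (i) : ts i = .var 1 := term_eq_var_one ((Set.subset_iUnion _ i).trans hv)
    obtain rfl : ts = fun _ => .var 1 := funext hts
    exact iff_of_false (fun h => lt_irrefl _ h.1) fun h => lt_irrefl _ h.1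
  | and A B ihA ihB =>
    obtain ⟨hA, hB'⟩ := Set.union_subset_iff.1 hv
    exact and_congr (ihA hB.1 hA w w' a a') (ihB hB.2 hB' w w' a a')
  | or A B ihA ihB =>
    obtain ⟨hA, hB'⟩ := Set.union_subset_iff.1 hv
    exact or_congr (ihA hB.1 hA w w' a a') (ihB hB.2 hB' w w' a a')
  | neg A ih => exact not_congr (ih hB hv w w' a a')
  | imp A B ihA ihB =>
    obtain ⟨hA, hB'⟩ := Set.union_subset_iff.1 hv
    have key (u u' : Bool) (b b' : ℕ → ℚ) (h : halfLineModel.Truth u b (.imp A B)) :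
        halfLineModel.Truth u' b' (.imp A B) := fun v v' _ hT =>
      (ihB hB.2 hB' _ _ _ _).1 (h u u (isRM.2.2.1 u) ((ihA hB.1 hA _ _ _ _).1 hT))
    exact ⟨key _ _ _ _, key _ _ _ _⟩
  | all x A => exact hB.elim
  | ex x A => exact hB.elim

theorem truth_phi : halfLineModel.Truth false (fun _ => (0 : ℚ)) phi := by
  refine ⟨?_, ?_⟩
  · rintro ⟨(x : ℚ), (h : x < 0), h'⟩
    exact h.not_ge (h'.resolve_left Bool.false_ne_true)
  · rintro w _ ⟨rfl, -⟩ -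
    exact ⟨(1 : ℚ), one_pos (α := ℚ), .inr (le_refl (0 : ℚ))⟩

theorem not_truth_phi (a : ℕ → ℚ) : ¬ halfLineModel.Truth true a phi := by
  rintro ⟨h, -⟩
  obtain ⟨x, hx⟩ := exists_lt (a 1)
  exact h ⟨x, hx, .inl rfl⟩

end halfLineModel

/-- **Failure of quantifier elimination for DLO** in any relevant logic between
**B** and **RM**: over any class `C` of `B`-models containing all `RM`-models,
the formula `¬∃x(x<y) ∧ (∀x(x=x) → ∃x(y<x))` is not DLO-equivalent over `C` to
any quantifier-free formula in the variable `y`. -/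
theorem stmt_4 (C : BModel dloSig → Prop) (hC : ∀ M : BModel dloSig, M.IsRM → C M) :
    ¬ ∃ B : Formula dloSig, B.QFree ∧ B.fv ⊆ {1} ∧ Entails C DLO.theory (phi.iff B) := by
  rintro ⟨B, hB, hv, h⟩
  obtain ⟨hphi, hB'⟩ :=
    h halfLineModel (hC _ halfLineModel.isRM) halfLineModel.satTheory fun _ => (0 : ℚ)
  exact halfLineModel.not_truth_phi _ <| hB' true true ⟨rfl, .inl rfl⟩ <|
    (halfLineModel.truth_iff_of_qFree hB hv _ _ _ _).1 <|
    hphi false false ⟨rfl, .inl rfl⟩ halfLineModel.truth_phi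
end

section
/- Failure of negation completeness for DLO over RM: let C be the class of all RM-models over the signature of DLO, and let A be the sentence ∀x¬(x<x) → ∀x∃y(y<x). Then neither DLO ⊨_C A nor DLO ⊨_C ¬A. Concretely, there exist RM-models M and N whose designated worlds satisfy all of DLO such that M,s ⊭ ¬A and N,s ⊭ A. -/
open RM

/-- The sentence `∀x¬(x<x) → ∀x∃y(y<x)`. -/
def sentA : Formula dloSig :=
  .imp (.all 0 (.neg (DLO.lt (DLO.v 0) (DLO.v 0))))
    (.all 0 (.ex 1 (DLO.lt (DLO.v 1) (DLO.v 0))))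


namespace RM

namespace BModel

/-- The model on worlds `W` and domain `ℚ` whose accessibility relation holds of `α, β, γ` exactly
when `β = γ`, whose star is the identity, and where `<` is read as `r w` at the world `w`. -/
def ofRelFamily (W : Type) (s : W) (r : W → ℚ → ℚ → Prop) : BModel dloSig where
  W := W
  R _ β γ := β = γ
  D := ℚ
  dne := ⟨0⟩
  star := id
  s := s
  interpFunc f := f.elim
  V w _ v := r w (v (0 : Fin 2)) (v (1 : Fin 2))
  base _ := rfl
  btrans _ _ _ _ _ h := h
  star_star _ := rfl
  star_anti _ _ h := h.symm
  hered _ _ h _ _ hv := h ▸ hv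

variable {W : Type} {s : W} {r : W → ℚ → ℚ → Prop}

theorem ofRelFamily_isRM : (ofRelFamily W s r).IsRM :=
  ⟨fun _ _ _ h => h.symm, fun _ _ _ h => h.symm, fun _ => rfl,
    fun _ _ _ δ ⟨_, _, h⟩ => ⟨δ, rfl, h⟩, fun _ _ _ h => Or.inr h⟩

theorem ofRelFamily_satTheory (hs : r s = (· < ·)) (hirrefl : ∀ w x, ¬ r w x x)
    (htrans : ∀ w x y z, r w x y → r w y z → r w x z)
    (hdense : ∀ w x y, r w x y → ∃ z, r w x z ∧ r w z y) :
    (ofRelFamily W s r).SatTheory DLO.theory := by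
  rintro A (rfl | rfl | rfl | rfl | rfl | rfl) a
  · rintro x w _ rfl h
    exact hirrefl w x h
  · intro x y
    change x = y ∨ r s x y ∨ r s y x
    rw [hs]
    exact or_left_comm.1 (lt_trichotomy (α := ℚ) x y)
  · rintro x y z w _ rfl ⟨hxy, hyz⟩
    exact htrans w x y z hxy hyz
  · rintro x y w _ rfl h
    exact hdense w x y h
  · intro x
    change ∃ y, r s x y
    rw [hs]
    exact exists_gt (α := ℚ) x
  · intro x
    change ∃ y, r s y x
    rw [hs]
    exact exists_lt (α := ℚ) x

theorem ofRelFamily_satAx_sentA :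
    (ofRelFamily W s r).SatAx sentA ↔ ∀ w, (∀ x, ¬ r w x x) → ∀ x, ∃ y, r w y x := by
  constructor
  · intro h w
    exact h (fun _ => (0 : ℚ)) w w rfl
  · rintro h a w _ rfl
    exact h w

theorem ofRelFamily_satAx_neg_sentA :
    (ofRelFamily W s r).SatAx (.neg sentA) ↔ ¬ (ofRelFamily W s r).SatAx sentA := by
  rw [ofRelFamily_satAx_sentA]
  constructor
  · intro h hA
    refine h (fun _ => (0 : ℚ)) ?_
    rintro w _ rfl
    exact hA w
  · intro h a hA
    exact h fun w => hA w w rfl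

end BModel

end RM

/-- **Failure of negation completeness for DLO over RM**: for the sentence
`A = ∀x¬(x<x) → ∀x∃y(y<x)`, there are `RM`-models of DLO refuting `¬A` and
refuting `A`; hence DLO entails neither `A` nor `¬A` over the class of all
`RM`-models. -/
theorem stmt_7 :
    (∃ M : BModel dloSig, M.IsRM ∧ M.SatTheory DLO.theory ∧ ¬ M.SatAx (.neg sentA)) ∧
    (∃ N : BModel dloSig, N.IsRM ∧ N.SatTheory DLO.theory ∧ ¬ N.SatAx sentA) ∧
    ¬ Entails (fun M : BModel dloSig => M.IsRM) DLO.theory sentA ∧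
    ¬ Entails (fun M : BModel dloSig => M.IsRM) DLO.theory (.neg sentA) := by
  have hM : ∃ M : BModel dloSig, M.IsRM ∧ M.SatTheory DLO.theory ∧ ¬ M.SatAx (.neg sentA) := by
    refine ⟨BModel.ofRelFamily Unit () fun _ => (· < ·), BModel.ofRelFamily_isRM,
      BModel.ofRelFamily_satTheory rfl (fun _ => lt_irrefl) (fun _ _ _ _ => lt_trans)
        (fun _ _ _ => exists_between), ?_⟩
    rw [BModel.ofRelFamily_satAx_neg_sentA, BModel.ofRelFamily_satAx_sentA, not_not]
    exact fun _ _ => exists_lt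
  have hN : ∃ N : BModel dloSig, N.IsRM ∧ N.SatTheory DLO.theory ∧ ¬ N.SatAx sentA := by
    refine ⟨BModel.ofRelFamily Bool true fun w x y => w = true ∧ x < y, BModel.ofRelFamily_isRM,
      BModel.ofRelFamily_satTheory (by simp) (by simp)
        (fun _ _ _ _ h h' => ⟨h.1, h.2.trans h'.2⟩)
        (fun _ _ _ h => (exists_between h.2).imp fun _ hz => ⟨⟨h.1, hz.1⟩, h.1, hz.2⟩), ?_⟩
    rw [BModel.ofRelFamily_satAx_sentA]
    intro h
    simpa using h false (by simp) 0
  refine ⟨hM, hN, fun h => ?_, fun h => ?_⟩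
  · obtain ⟨N, hRM, hT, hA⟩ := hN
    exact hA (h N hRM hT)
  · obtain ⟨M, hRM, hT, hA⟩ := hM
    exact hA (h M hRM hT)
end

section
/- Failure of quantifier elimination for Presburger arithmetic in any relevant logic between B and RM: let C be any class of B-models over the signature of Presburger arithmetic that contains every RM-model. Then there is a formula A(x) for which no quantifier-free formula B(x) of the language satisfies Presburger ⊨_C A↔B. Hence Presburger arithmetic does not admit quantifier elimination over C. -/
open RM

/-- Function symbols of the signature of Presburger arithmetic. -/
inductive PresFunc : Type where
  | plus | zero | one

/-- The signature of Presburger arithmetic: `+ 0 1`, the binary relation `<`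
and a unary predicate `Pₙ` for each `n > 1`. -/
def presSig : Signature :=
  ⟨PresFunc, fun f => match f with | .plus => 2 | .zero => 0 | .one => 0,
   Unit ⊕ {n : ℕ // 1 < n},
   fun r => match r with | .inl _ => 2 | .inr _ => 1⟩

namespace Pres

def v (n : ℕ) : Term presSig := .var n
def lt (t u : Term presSig) : Formula presSig := .rel (.inl ()) ![t, u]
def P (n : {n : ℕ // 1 < n}) (t : Term presSig) : Formula presSig := .rel (.inr n) ![t]
def add (t u : Term presSig) : Term presSig := .func .plus ![t, u]
def c0 : Term presSig := .func .zero ![]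
def c1 : Term presSig := .func .one ![]

/-- `t + ⋯ + t` (`n` times). -/
def nsum (t : Term presSig) : ℕ → Term presSig
  | 0 => c0
  | 1 => t
  | n + 2 => add t (nsum t (n + 1))

/-- The term `x + 1 + ⋯ + 1` (`i` ones), where `x` is the variable `0`. -/
def addOnes : ℕ → Term presSig
  | 0 => v 0
  | i + 1 => add (addOnes i) c1

/-- Disjunction of a list of formulas. -/
def bigOr : List (Formula presSig) → Formula presSig
  | [] => .falsum
  | [A] => A
  | A :: B :: l => .or A (bigOr (B :: l))

/-- Conjunction of a list of formulas. -/
def bigAnd : List (Formula presSig) → Formula presSig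
  | [] => .verum
  | [A] => A
  | A :: B :: l => .and A (bigAnd (B :: l))

def ax1 : Formula presSig := .all 0 (.imp (lt (v 0) (v 0)) .falsum)
def ax2 : Formula presSig :=
  .all 0 (.all 1 (.or (.equal (v 0) (v 1)) (.or (lt (v 0) (v 1)) (lt (v 1) (v 0)))))
def ax3 : Formula presSig :=
  .all 0 (.all 1 (.all 2 (.imp (.and (lt (v 0) (v 1)) (lt (v 1) (v 2))) (lt (v 0) (v 2)))))
def ax4 : Formula presSig :=
  .all 0 (.all 1 (.all 2 (.imp (lt (v 0) (v 1)) (lt (add (v 0) (v 2)) (add (v 1) (v 2))))))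
def ax5 : Formula presSig :=
  .all 0 (.all 1 (.all 2 (.equal (add (add (v 0) (v 1)) (v 2)) (add (v 0) (add (v 1) (v 2))))))
def ax6 : Formula presSig := .all 0 (.equal (add (v 0) c0) (v 0))
def ax7 : Formula presSig := .all 0 (.all 1 (.equal (add (v 0) (v 1)) (add (v 1) (v 0))))
def ax8 : Formula presSig := lt c0 c1
def ax9 : Formula presSig :=
  .all 0 (.or (.or (.equal (v 0) c0) (lt (v 0) c0)) (.or (lt c1 (v 0)) (.equal (v 0) c1)))
/-- A10ₙ: `∀x(Pₙ(x) ↔ ∃y(x = y + ⋯ + y))` (`n` times), for `n > 1`. -/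
def ax10 (n : {n : ℕ // 1 < n}) : Formula presSig :=
  .all 0 (Formula.iff (P n (v 0)) (.ex 1 (.equal (v 0) (nsum (v 1) n.1))))
/-- A11ₙ: `∀x ⋁_{i<n} (Pₙ(x+i·1) ∧ ⋀_{j<n, j≠i} (Pₙ(x+j·1) → ⊥))`, for `n > 1`. -/
def ax11 (n : {n : ℕ // 1 < n}) : Formula presSig :=
  .all 0 (bigOr ((List.range n.1).map fun i =>
    Formula.and (P n (addOnes i))
      (bigAnd (((List.range n.1).filter (fun j => j ≠ i)).map fun j =>
        Formula.imp (P n (addOnes j)) Formula.falsum))))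

/-- The theory of Presburger arithmetic. -/
def theory : Set (Formula presSig) :=
  {ax1, ax2, ax3, ax4, ax5, ax6, ax7, ax8, ax9} ∪
  {A | ∃ n, A = ax10 n} ∪ {A | ∃ n, A = ax11 n}

end Pres


namespace Pres

/-- Function symbols interpreted on the integers. -/
def intFunc : (f : PresFunc) → (Fin (presSig.farity f) → ℤ) → ℤ
  | .plus, u => u (0 : Fin 2) + u (1 : Fin 2)
  | .zero, _ => 0
  | .one, _ => 1

/-- At world `n`, the symbol `<` means "less than and congruent modulo `n`" (so it is empty at
world `0` and standard at world `1`), and `Pₘ` means divisibility by `m`. -/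
def intRel (n : ℕ) : (r : presSig.Rel) → (Fin (presSig.rarity r) → ℤ) → Prop
  | .inl _, u => u (0 : Fin 2) < u (1 : Fin 2) ∧ (n : ℤ) ∣ u (1 : Fin 2) - u (0 : Fin 2)
  | .inr m, u => (m.1 : ℤ) ∣ u (0 : Fin 1)

/-- The model with a world for each natural number and designated world `1`; every world other
than `1` only sees itself. -/
def congModel : BModel presSig where
  W := ℕ
  R a b c := b = c ∧ (a = 1 ∨ a = b)
  D := ℤ
  dne := ⟨0⟩
  star := id
  s := 1
  interpFunc := intFunc
  V := intRel
  base _ := ⟨rfl, .inl rfl⟩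
  btrans := by rintro α β γ δ ⟨rfl, -⟩ h; exact h
  star_star _ := rfl
  star_anti := by rintro α β ⟨rfl, -⟩; exact ⟨rfl, .inl rfl⟩
  hered := by rintro α β ⟨rfl, -⟩ r u h; exact h

theorem congModel_isRM : congModel.IsRM := by
  refine ⟨?_, ?_, ?_, ?_, ?_⟩
  · rintro α β γ ⟨rfl, h⟩
    exact ⟨rfl, h⟩
  · rintro α β γ ⟨rfl, h⟩
    exact ⟨rfl, h⟩
  · exact fun α => ⟨rfl, .inr rfl⟩
  · rintro α β γ δ ⟨x, ⟨rfl, h⟩, ⟨rfl, h'⟩⟩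
    refine ⟨γ, ⟨rfl, ?_⟩, ⟨rfl, h'⟩⟩
    rcases h with h | rfl
    · exact .inl h
    · exact h'
  · rintro α β γ ⟨rfl, -⟩
    exact .inr ⟨rfl, .inl rfl⟩

section Truth

variable (w : ℕ) (a : ℕ → ℤ)

/-- Value of a term in the integers. -/
def val (a : ℕ → ℤ) (t : Term presSig) : ℤ := congModel.evalT a t

/-- Truth in the model of congruence orders. -/
def Holds (w : ℕ) (a : ℕ → ℤ) (A : Formula presSig) : Prop := congModel.Truth w a A

@[simp] theorem val_v (n : ℕ) : val a (v n) = a n := rfl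
@[simp] theorem val_add (t u : Term presSig) : val a (add t u) = val a t + val a u := rfl
@[simp] theorem val_c0 : val a c0 = 0 := rfl
@[simp] theorem val_c1 : val a c1 = 1 := rfl

@[simp] theorem val_nsum (t : Term presSig) : ∀ n, val a (nsum t n) = n * val a t
  | 0 => by simp [nsum]
  | 1 => by simp [nsum]
  | n + 2 => by
    rw [nsum, val_add, val_nsum t (n + 1)]
    push_cast
    ring

@[simp] theorem val_addOnes : ∀ n, val a (addOnes n) = a 0 + n
  | 0 => by simp [addOnes]
  | n + 1 => by
    rw [addOnes, val_add, val_addOnes n, val_c1]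
    push_cast
    ring

@[simp] theorem holds_falsum : Holds w a .falsum ↔ False := Iff.rfl
@[simp] theorem holds_verum : Holds w a .verum ↔ True := Iff.rfl
@[simp] theorem holds_equal (t u : Term presSig) :
    Holds w a (.equal t u) ↔ val a t = val a u := Iff.rfl
@[simp] theorem holds_lt (t u : Term presSig) :
    Holds w a (lt t u) ↔ val a t < val a u ∧ (w : ℤ) ∣ val a u - val a t := Iff.rfl
@[simp] theorem holds_P (n : {n : ℕ // 1 < n}) (t : Term presSig) :
    Holds w a (P n t) ↔ (n.1 : ℤ) ∣ val a t := Iff.rfl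
@[simp] theorem holds_and (A B : Formula presSig) :
    Holds w a (.and A B) ↔ Holds w a A ∧ Holds w a B := Iff.rfl
@[simp] theorem holds_or (A B : Formula presSig) :
    Holds w a (.or A B) ↔ Holds w a A ∨ Holds w a B := Iff.rfl
@[simp] theorem holds_neg (A : Formula presSig) : Holds w a (.neg A) ↔ ¬ Holds w a A := Iff.rfl
@[simp] theorem holds_all (x : ℕ) (A : Formula presSig) :
    Holds w a (.all x A) ↔ ∀ d : ℤ, Holds w (Function.update a x d) A := Iff.rfl
@[simp] theorem holds_ex (x : ℕ) (A : Formula presSig) :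
    Holds w a (.ex x A) ↔ ∃ d : ℤ, Holds w (Function.update a x d) A := Iff.rfl

@[simp] theorem holds_one_imp (A B : Formula presSig) :
    Holds 1 a (.imp A B) ↔ ∀ w : ℕ, Holds w a A → Holds w a B :=
  ⟨fun h w => h w w ⟨rfl, .inl rfl⟩, by rintro h w _ ⟨rfl, -⟩; exact h w⟩

theorem holds_imp_of_ne_one {w : ℕ} (hw : w ≠ 1) (A B : Formula presSig) :
    Holds w a (.imp A B) ↔ (Holds w a A → Holds w a B) := by
  refine ⟨fun h => h w w ⟨rfl, .inr rfl⟩, ?_⟩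
  rintro h w₁ _ ⟨rfl, rfl | rfl⟩
  · exact absurd rfl hw
  · exact h

theorem holds_bigOr : ∀ l : List (Formula presSig),
    Holds w a (bigOr l) ↔ ∃ A ∈ l, Holds w a A
  | [] => by simp [bigOr]
  | [A] => by simp [bigOr]
  | A :: B :: l => by rw [bigOr, holds_or, holds_bigOr (B :: l)]; simp

theorem holds_bigAnd : ∀ l : List (Formula presSig),
    Holds w a (bigAnd l) ↔ ∀ A ∈ l, Holds w a A
  | [] => by simp [bigAnd]
  | [A] => by simp [bigAnd]
  | A :: B :: l => by rw [bigAnd, holds_and, holds_bigAnd (B :: l)]; simp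

end Truth

theorem holds_ax10 (n : {n : ℕ // 1 < n}) (a : ℕ → ℤ) : Holds 1 a (ax10 n) := by
  simp [ax10, Formula.iff, dvd_iff_exists_eq_mul_right]

theorem holds_ax11 (n : {n : ℕ // 1 < n}) (a : ℕ → ℤ) : Holds 1 a (ax11 n) := by
  obtain ⟨n, hn⟩ := n
  rw [ax11, holds_all]
  intro d
  have hpos : (0 : ℤ) < n := by omega
  have hlo := Int.emod_nonneg (-d) hpos.ne'
  have hhi := Int.emod_lt_of_pos (-d) hpos
  obtain ⟨i, hi⟩ := Int.eq_ofNat_of_zero_le hlo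
  have hdvd : (n : ℤ) ∣ d + i := by
    rw [← hi, Int.emod_def]
    exact ⟨-(-d / n), by ring⟩
  rw [holds_bigOr]
  refine ⟨_, List.mem_map_of_mem (List.mem_range.2 (show i < n by omega)), ?_⟩
  rw [holds_and, holds_bigAnd]
  refine ⟨by simpa using hdvd, ?_⟩
  simp only [List.mem_map, List.mem_filter, List.mem_range, forall_exists_index, and_imp]
  rintro _ j hj hji rfl
  rw [holds_one_imp]
  intro w h
  have h : (n : ℤ) ∣ d + j := by simpa using h
  have hsub : (n : ℤ) ∣ j - i := by simpa using dvd_sub h hdvd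
  have := Int.eq_zero_of_abs_lt_dvd hsub (by rw [abs_lt]; omega)
  have hji : j ≠ i := by simpa using hji
  omega

theorem holds_of_mem_theory {A : Formula presSig} (hA : A ∈ theory) (a : ℕ → ℤ) : Holds 1 a A := by
  rcases hA with (hA | ⟨n, rfl⟩) | ⟨n, rfl⟩
  · rcases hA with rfl | rfl | rfl | rfl | rfl | rfl | rfl | rfl | rfl
    · simp [ax1]
    · simp only [ax2, holds_all, holds_or, holds_equal, holds_lt, val_v]
      intro x y
      simp
      omega
    · simp only [ax3, holds_all, holds_one_imp, holds_and, holds_lt, val_v]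
      rintro x y z w ⟨⟨h₁, h₂⟩, h₃, h₄⟩
      exact ⟨h₁.trans h₃, by simpa using dvd_add h₄ h₂⟩
    · simp +contextual [ax4]
    · simp [ax5, add_assoc]
    · simp [ax6]
    · simp [ax7, add_comm]
    · simp [ax8]
    · simp only [ax9, holds_all, holds_or, holds_equal, holds_lt, val_v, val_c0, val_c1]
      intro x
      simp
      omega
  · exact holds_ax10 n a
  · exact holds_ax11 n a

theorem congModel_satTheory : congModel.SatTheory theory :=
  fun _ hA a => holds_of_mem_theory hA a

/-- A quantifier-free formula cannot distinguish world `0` from worlds of large index. -/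
theorem eventually_holds_iff_of_qFree (a : ℕ → ℤ) (B : Formula presSig) (hB : B.QFree) :
    ∀ᶠ n : ℕ in Filter.atTop, (Holds n a B ↔ Holds 0 a B) := by
  induction B with
  | falsum => exact .of_forall fun n => Iff.rfl
  | verum => exact .of_forall fun n => Iff.rfl
  | equal t u => exact .of_forall fun n => Iff.rfl
  | rel r ts =>
    rcases r with r | m
    · set x := val a (ts (0 : Fin 2)) with hx
      set y := val a (ts (1 : Fin 2)) with hy
      have key (n : ℕ) : Holds n a (.rel (.inl r) ts) ↔ x < y ∧ (n : ℤ) ∣ y - x := Iff.rfl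
      filter_upwards [Filter.eventually_gt_atTop (y - x).natAbs] with n hn
      rw [key, key]
      refine and_congr_right fun hxy => iff_of_false (fun h => ?_) (fun h => ?_)
      · have := Int.le_of_dvd (by omega) h
        omega
      · rw [Nat.cast_zero, zero_dvd_iff] at h
        omega
    · exact .of_forall fun n => Iff.rfl
  | and A B ihA ihB =>
    filter_upwards [ihA hB.1, ihB hB.2] with n hA hB
    rw [holds_and, holds_and, hA, hB]
  | or A B ihA ihB =>
    filter_upwards [ihA hB.1, ihB hB.2] with n hA hB
    rw [holds_or, holds_or, hA, hB]
  | neg A ih =>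
    filter_upwards [ih hB] with n hA
    rw [holds_neg, holds_neg, hA]
  | imp A B ihA ihB =>
    filter_upwards [ihA hB.1, ihB hB.2, Filter.eventually_gt_atTop 1] with n hA hB hn
    rw [holds_imp_of_ne_one a hn.ne', holds_imp_of_ne_one a zero_ne_one, hA, hB]
  | all x A => exact hB.elim
  | ex x A => exact hB.elim

end Pres

/-- **Failure of quantifier elimination for Presburger arithmetic** in any
relevant logic between **B** and **RM**: over any class `C` of `B`-models
containing all `RM`-models, there is a formula `A(x)` that is not equivalent
(relative to the Presburger axioms, over `C`) to any quantifier-free formula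
`B(x)`. -/
theorem stmt_10 (C : BModel presSig → Prop) (hC : ∀ M : BModel presSig, M.IsRM → C M) :
    ∃ A : Formula presSig, A.fv ⊆ {0} ∧
      ¬ ∃ B : Formula presSig, B.QFree ∧ B.fv ⊆ {0} ∧ Entails C Pres.theory (A.iff B) := by
  refine ⟨.ex 1 (Pres.lt (Pres.v 0) (Pres.v 1)), ?_, ?_⟩
  · rintro x ⟨hx, hx1⟩
    obtain ⟨i, hi⟩ := Set.mem_iUnion.1 hx
    change Fin 2 at i
    fin_cases i
    · exact hi
    · exact absurd hi hx1
  · rintro ⟨B, hB, -, hent⟩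
    have h : Pres.Holds 1 (fun _ => 0) (.iff (.ex 1 (Pres.lt (Pres.v 0) (Pres.v 1))) B) :=
      hent Pres.congModel (hC _ Pres.congModel_isRM) Pres.congModel_satTheory _
    rw [Formula.iff, Pres.holds_and, Pres.holds_one_imp, Pres.holds_one_imp] at h
    obtain ⟨n, hn, hpos⟩ := ((Pres.eventually_holds_iff_of_qFree (fun _ => 0) B hB).and
      (Filter.eventually_gt_atTop 0)).exists
    have h0 := h.2 0 (hn.1 (h.1 n ((Pres.holds_ex _ _ _ _).2 ⟨(n : ℤ), by simpa using hpos⟩)))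
    simp only [Pres.holds_ex, Pres.holds_lt, Pres.val_v] at h0
    obtain ⟨d, hd, hdvd⟩ := h0
    rw [Nat.cast_zero, zero_dvd_iff] at hdvd
    omega
end

section
/- Failure of quantifier elimination for DOAG in any relevant logic between B and RM: let C be any class of B-models over the signature of DOAG that contains every RM-model. Then there is a formula A(x) for which no quantifier-free formula B(x) of the language satisfies DOAG ⊨_C A↔B. Hence the theory of divisible ordered abelian groups does not admit quantifier elimination over C. -/
open RM

/-- Function symbols of the signature of DOAG. -/
inductive DoagFunc : Type where
  | plus | neg | zero

/-- The signature of DOAG: `+ − 0` and the binary relation `<`. -/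
def doagSig : Signature :=
  ⟨DoagFunc, fun f => match f with | .plus => 2 | .neg => 1 | .zero => 0,
   Unit, fun _ => 2⟩

namespace DOAG

def v (n : ℕ) : Term doagSig := .var n
def lt (t u : Term doagSig) : Formula doagSig := .rel () ![t, u]
def add (t u : Term doagSig) : Term doagSig := .func .plus ![t, u]
def minus (t : Term doagSig) : Term doagSig := .func .neg ![t]
def c0 : Term doagSig := .func .zero ![]

/-- `t + ⋯ + t` (`n` times). -/
def nsum (t : Term doagSig) : ℕ → Term doagSig
  | 0 => c0
  | 1 => t
  | n + 2 => add t (nsum t (n + 1))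

def ax1 : Formula doagSig := .all 0 (.imp (lt (v 0) (v 0)) .falsum)
def ax2 : Formula doagSig :=
  .all 0 (.all 1 (.or (.equal (v 0) (v 1)) (.or (lt (v 0) (v 1)) (lt (v 1) (v 0)))))
def ax3 : Formula doagSig :=
  .all 0 (.all 1 (.all 2 (.imp (.and (lt (v 0) (v 1)) (lt (v 1) (v 2))) (lt (v 0) (v 2)))))
def ax4 : Formula doagSig :=
  .all 0 (.all 1 (.all 2 (.imp (lt (v 0) (v 1)) (lt (add (v 0) (v 2)) (add (v 1) (v 2))))))
/-- A5ₙ: `∀y∃x(x + ⋯ + x = y)` (`n` times), for `n > 1`. -/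
def ax5 (n : ℕ) : Formula doagSig := .all 1 (.ex 0 (.equal (nsum (v 0) n) (v 1)))
def ax6 : Formula doagSig :=
  .all 0 (.all 1 (.all 2 (.equal (add (add (v 0) (v 1)) (v 2)) (add (v 0) (add (v 1) (v 2))))))
def ax7 : Formula doagSig := .all 0 (.equal (add (v 0) c0) (v 0))
def ax8 : Formula doagSig := .all 0 (.equal (add (v 0) (minus (v 0))) c0)
def ax9 : Formula doagSig := .all 0 (.all 1 (.equal (add (v 0) (v 1)) (add (v 1) (v 0))))

/-- The theory DOAG of divisible ordered abelian groups. -/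
def theory : Set (Formula doagSig) :=
  {ax1, ax2, ax3, ax4, ax6, ax7, ax8, ax9} ∪ {A | ∃ n : ℕ, 1 < n ∧ A = ax5 n}

end DOAG


namespace DOAG

/-- The two-world `RM`-model over `ℚ` with `R α β γ ↔ β = γ` and trivial star, in which `<` is the
usual order at the worlds satisfying `p` and is empty at the others. -/
abbrev ratModel (p : Bool → Prop) : BModel doagSig where
  W := Bool
  R _ β γ := β = γ
  D := ℚ
  dne := ⟨0⟩
  star := id
  s := true
  interpFunc f := match f with
    | .plus => fun u : Fin 2 → ℚ => u 0 + u 1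
    | .neg => fun u : Fin 1 → ℚ => -u 0
    | .zero => fun _ => 0
  V w _ := fun u : Fin 2 → ℚ => p w ∧ u 0 < u 1
  base _ := rfl
  btrans _ _ _ _ _ h := h
  star_star _ := rfl
  star_anti _ _ h := h.symm
  hered _ _ h _ _ hv := h ▸ hv

theorem ratModel_isRM (p : Bool → Prop) : (ratModel p).IsRM :=
  ⟨fun _ _ _ h => h.symm, fun _ _ _ h => h.symm, fun _ => rfl,
    fun _ _ γ _ ⟨_, _, h⟩ => ⟨γ, h, rfl⟩, fun _ _ _ h => .inr h⟩

section

variable (p : Bool → Prop) (a : ℕ → ℚ)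

theorem evalT_c0 : (ratModel p).evalT a c0 = (0 : ℚ) := rfl

theorem evalT_add (t u : Term doagSig) : (ratModel p).evalT a (add t u) =
    ((ratModel p).evalT a t + (ratModel p).evalT a u : ℚ) := rfl

theorem evalT_nsum (t : Term doagSig) (n : ℕ) :
    (ratModel p).evalT a (nsum t n) = (n * (ratModel p).evalT a t : ℚ) := by
  induction n using nsum.induct with
  | case1 => simp [nsum, evalT_c0]
  | case2 => simp [nsum]
  | case3 n ih =>
    rw [nsum, evalT_add, ih]
    push_cast
    ring

theorem evalT_zero (t : Term doagSig) : (ratModel p).evalT (fun _ => (0 : ℚ)) t = (0 : ℚ) := by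
  induction t with
  | var n => rfl
  | func f ts ih =>
    cases f with
    | plus => exact (congrArg₂ (· + ·) (ih (0 : Fin 2)) (ih (1 : Fin 2))).trans (add_zero 0)
    | neg => exact (congrArg (- ·) (ih (0 : Fin 1))).trans neg_zero
    | zero => rfl

end

theorem ratModel_satTheory {p : Bool → Prop} (hp : p true) : (ratModel p).SatTheory theory := by
  rintro A (h | ⟨n, hn, rfl⟩) a
  · simp only [Set.mem_insert_iff, Set.mem_singleton_iff] at h
    rcases h with rfl | rfl | rfl | rfl | rfl | rfl | rfl | rfl
    · rintro d w _ rfl ⟨_, h⟩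
      exact lt_irrefl _ h
    · intro d e
      rcases lt_trichotomy (d : ℚ) e with h | h | h
      · exact .inr (.inl ⟨hp, h⟩)
      · exact .inl h
      · exact .inr (.inr ⟨hp, h⟩)
    · rintro d e f w _ rfl ⟨⟨hw, h⟩, ⟨_, h'⟩⟩
      exact ⟨hw, lt_trans h h'⟩
    · rintro d e f w _ rfl ⟨hw, h⟩
      exact ⟨hw, add_lt_add_left (α := ℚ) h f⟩
    · exact fun d e f => add_assoc (G := ℚ) d e f
    · exact fun d => add_zero (M := ℚ) d
    · exact fun d => add_neg_cancel (G := ℚ) d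
    · exact fun d e => add_comm (G := ℚ) d e
  · intro d
    refine ⟨(d / n : ℚ), ?_⟩
    have hn0 : (n : ℚ) ≠ 0 := by positivity
    exact (evalT_nsum p _ (v 0) n).trans (mul_div_cancel₀ (d : ℚ) hn0)

/-- At the zero assignment, quantifier-free formulas do not see where the order is empty. -/
theorem truth_zero_iff_of_qFree (p q : Bool → Prop) {B : Formula doagSig} (hB : B.QFree)
    (w w' : Bool) : (ratModel p).Truth w (fun _ => (0 : ℚ)) B ↔
      (ratModel q).Truth w' (fun _ => (0 : ℚ)) B := by
  induction B generalizing w w' with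
  | falsum => exact Iff.rfl
  | verum => exact Iff.rfl
  | equal t u => simp only [BModel.Truth, evalT_zero]
  | rel r ts =>
    cases r
    simp only [BModel.Truth, evalT_zero, lt_irrefl, and_false]
  | and A B ihA ihB => exact and_congr (ihA hB.1 w w') (ihB hB.2 w w')
  | or A B ihA ihB => exact or_congr (ihA hB.1 w w') (ihB hB.2 w w')
  | neg A ih => exact not_congr (ih hB w w')
  | imp A B ihA ihB =>
    constructor
    · rintro h x _ rfl hA
      exact (ihB hB.2 w x).1 (h w w rfl ((ihA hB.1 w x).2 hA))
    · rintro h x _ rfl hA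
      exact (ihB hB.2 x w').2 (h w' w' rfl ((ihA hB.1 x w').1 hA))
  | all => exact hB.elim
  | ex => exact hB.elim

/-- The sentence `∀x(⊤ → (x = 0 ∨ x < 0 ∨ 0 < x))`, comparability with `0` at all worlds
accessible from the designated one. -/
def comparable : Formula doagSig :=
  .all 0 (.imp .verum (.or (.equal (v 0) c0) (.or (lt (v 0) c0) (lt c0 (v 0)))))

theorem comparable_fv : comparable.fv ⊆ {0} := by
  rintro n ⟨hn, hn0⟩
  simp only [Formula.fv, lt, v, c0, Term.fv, Set.mem_union, Set.mem_iUnion, Set.mem_empty_iff_false,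
    Set.mem_singleton_iff, false_or] at hn
  rcases hn with (hn | ⟨i, _⟩) | ⟨i, hn⟩ | ⟨i, hn⟩
  · exact hn
  · exact Fin.elim0 i
  all_goals
    change Fin 2 at i
    fin_cases i <;> simp [Term.fv] at hn <;> first | exact hn | exact Fin.elim0 hn.choose

theorem truth_comparable_iff (p : Bool → Prop) (a : ℕ → ℚ) :
    (ratModel p).Truth true a comparable ↔ ∀ w, p w := by
  constructor
  · intro h w
    rcases h (1 : ℚ) w w rfl trivial with h | h | h
    · exact absurd h (one_ne_zero (α := ℚ))
    · exact h.1
    · exact h.1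
  · rintro h d w _ rfl -
    rcases lt_trichotomy (d : ℚ) 0 with hd | hd | hd
    · exact .inr (.inl ⟨h w, hd⟩)
    · exact .inl hd
    · exact .inr (.inr ⟨h w, hd⟩)

end DOAG


/-- **Failure of quantifier elimination for DOAG** in any relevant logic
between **B** and **RM**: over any class `C` of `B`-models containing all
`RM`-models, there is a formula `A(x)` that is not equivalent (relative to the
DOAG axioms, over `C`) to any quantifier-free formula `B(x)`. -/
theorem stmt_11 (C : BModel doagSig → Prop) (hC : ∀ M : BModel doagSig, M.IsRM → C M) :
    ∃ A : Formula doagSig, A.fv ⊆ {0} ∧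
      ¬ ∃ B : Formula doagSig, B.QFree ∧ B.fv ⊆ {0} ∧ Entails C DOAG.theory (A.iff B) := by
  refine ⟨DOAG.comparable, DOAG.comparable_fv, ?_⟩
  rintro ⟨B, hB, -, hent⟩
  have key (p : Bool → Prop) (hp : p true) :
      (∀ w, p w) ↔ (DOAG.ratModel p).Truth true (fun _ => (0 : ℚ)) B := by
    have h := hent _ (hC _ (DOAG.ratModel_isRM p)) (DOAG.ratModel_satTheory hp) fun _ => (0 : ℚ)
    rw [← DOAG.truth_comparable_iff p fun _ => 0]
    exact ⟨h.1 true true rfl, h.2 true true rfl⟩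
  have hfull := (key (fun _ => True) trivial).1 fun _ => trivial
  have hpart := (key (· = true) rfl).2
    ((DOAG.truth_zero_iff_of_qFree (fun _ => True) _ hB true true).1 hfull)
  exact Bool.false_ne_true (hpart false)
end

section
/- World-independence of truth in DLO models under K and seriality: let M=⟨W,R,D,*,s,V⟩ be a B-model over the signature of DLO satisfying the K condition and seriality, whose designated world s satisfies all axioms of DLO. Then for every formula A, every world w ∈ W, and every assignment ā of elements of D to the free variables of A: M,w ⊨ A[ā] if and only if M,s ⊨ A[ā]. -/
open RM

namespace RM.BModel

/-- Under the `K` condition, the designated world lies below every world. -/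
theorem Kcond.base_le {σ : Signature} {M : BModel σ} (hK : M.Kcond) (w : M.W) :
    M.R M.s M.s w :=
  hK _ _ _ (M.base w)

/-- Over a serial frame, if the truth of `A` and of `B` is world-independent, then `A → B` is
evaluated materially at every world. -/
theorem Serial.truth_imp_iff {σ : Signature} {M : BModel σ} (hS : M.Serial)
    {A B : Formula σ} {a : ℕ → M.D} (hA : ∀ w, M.Truth w a A ↔ M.Truth M.s a A)
    (hB : ∀ w, M.Truth w a B ↔ M.Truth M.s a B) (w : M.W) :
    M.Truth w a (.imp A B) ↔ (M.Truth M.s a A → M.Truth M.s a B) := by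
  refine ⟨fun h hs => ?_, fun h w₁ w₂ _ h₁ => (hB w₂).2 (h ((hA w₁).1 h₁))⟩
  obtain ⟨y, z, hyz⟩ := hS w
  exact (hB z).1 (h y z hyz ((hA y).2 hs))

/-- If every atomic formula is world-independent in a serial model, so is every formula. -/
theorem Serial.truth_iff {σ : Signature} {M : BModel σ} (hS : M.Serial)
    (hV : ∀ w r v, M.V w r v ↔ M.V M.s r v) (A : Formula σ) (w : M.W) (a : ℕ → M.D) :
    M.Truth w a A ↔ M.Truth M.s a A := by
  induction A generalizing w a with
  | falsum | verum | equal => exact Iff.rfl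
  | rel r ts => exact hV w r _
  | and A B ihA ihB => exact and_congr (ihA w a) (ihB w a)
  | or A B ihA ihB => exact or_congr (ihA w a) (ihB w a)
  | neg A ih => exact not_congr ((ih _ a).trans (ih _ a).symm)
  | imp A B ihA ihB =>
    rw [hS.truth_imp_iff (ihA · a) (ihB · a) w, hS.truth_imp_iff (ihA · a) (ihB · a) M.s]
  | all x A ih => exact forall_congr' fun d => ih w _
  | ex x A ih => exact exists_congr fun d => ih w _

end RM.BModel

namespace DLO

variable {M : BModel dloSig}

theorem evalT_pair (a : ℕ → M.D) (i j : ℕ) :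
    (fun k => M.evalT a ((![v i, v j] : Fin 2 → Term dloSig) k)) = ![a i, a j] := by
  funext k
  fin_cases k <;> rfl

theorem truth_lt (w : M.W) (a : ℕ → M.D) (i j : ℕ) :
    M.Truth w a (lt (v i) (v j)) ↔ M.V w () ![a i, a j] :=
  iff_of_eq (congrArg (M.V w ()) (evalT_pair a i j))

theorem irrefl (hT : M.SatTheory theory) (w : M.W) (x : M.D) : ¬ M.V w () ![x, x] := by
  intro h
  have h1 := hT ax1 (by simp [theory]) (fun _ => x) x w w (M.base w)
  exact h1 ((truth_lt w _ 0 0).2 (by simpa using h))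

theorem trans (hT : M.SatTheory theory) (w : M.W) {x y z : M.D}
    (hxy : M.V w () ![x, y]) (hyz : M.V w () ![y, z]) : M.V w () ![x, z] := by
  have h3 := hT ax3 (by simp [theory]) (fun _ => x) x y z w w (M.base w)
    ⟨(truth_lt w _ 0 1).2 (by simpa using hxy), (truth_lt w _ 1 2).2 (by simpa using hyz)⟩
  simpa using (truth_lt w _ 0 2).1 h3

theorem trichotomy (hT : M.SatTheory theory) (x y : M.D) :
    x = y ∨ M.V M.s () ![x, y] ∨ M.V M.s () ![y, x] := by
  rcases hT ax2 (by simp [theory]) (fun _ => x) x y with h | h | h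
  · exact Or.inl (by simpa [BModel.Truth, BModel.evalT, v] using h)
  · exact Or.inr (Or.inl (by simpa using (truth_lt _ _ 0 1).1 h))
  · exact Or.inr (Or.inr (by simpa using (truth_lt _ _ 1 0).1 h))

/-- In a model of DLO satisfying the `K` condition, the order is the same at every world. -/
theorem lt_iff (hK : M.Kcond) (hT : M.SatTheory theory) (w : M.W) (x y : M.D) :
    M.V w () ![x, y] ↔ M.V M.s () ![x, y] := by
  refine ⟨fun h => ?_, M.hered _ _ (hK.base_le w) _ _⟩
  rcases trichotomy hT x y with rfl | hxy | hyx
  · exact (irrefl hT w x h).elim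
  · exact hxy
  · exact (irrefl hT w x (trans hT w h (M.hered _ _ (hK.base_le w) _ _ hyx))).elim

end DLO

/-- **World-independence of truth** in models of DLO satisfying the `K`
condition and seriality: truth at any world coincides with truth at the
designated world. -/
theorem stmt_12 (M : BModel dloSig) (hK : M.Kcond) (hS : M.Serial)
    (hT : M.SatTheory DLO.theory) (A : Formula dloSig) (w : M.W) (a : ℕ → M.D) :
    M.Truth w a A ↔ M.Truth M.s a A := by
  refine hS.truth_iff (fun w r u => ?_) A w a
  have hu : u = ![u (0 : Fin 2), u (1 : Fin 2)] := by
    funext k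
    fin_cases k <;> rfl
  rw [hu]
  exact DLO.lt_iff hK hT w _ _
end

section
/- Negation completeness of DLO over B + K with seriality: let C be the class of all B-models over the signature of DLO satisfying the K condition and seriality. Then for every sentence A of the language of DLO, either DLO ⊨_C A or DLO ⊨_C ¬A. -/
open RM

/-- The axioms of strict dense linear orders without endpoints, for a binary relation. -/
structure IsStrictDLO {D : Type*} (r : D → D → Prop) : Prop where
  irrefl : ∀ x, ¬ r x x
  trans : ∀ x y z, r x y → r y z → r x z
  total : ∀ x y, x = y ∨ r x y ∨ r y x
  dense : ∀ x y, r x y → ∃ z, r x z ∧ r z y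
  noMax : ∀ x, ∃ y, r x y
  noMin : ∀ x, ∃ y, r y x

/-- Two assignments are order-similar on a set of variables. -/
def OrderSimilar {D E : Type*} (r : D → D → Prop) (q : E → E → Prop) (S : Finset ℕ)
    (a : ℕ → D) (b : ℕ → E) : Prop :=
  ∀ i ∈ S, ∀ j ∈ S, (r (a i) (a j) ↔ q (b i) (b j))

theorem OrderSimilar.symm {D E : Type*} {r : D → D → Prop} {q : E → E → Prop} {S : Finset ℕ}
    {a : ℕ → D} {b : ℕ → E} (h : OrderSimilar r q S a b) : OrderSimilar q r S b a :=
  fun i hi j hj => (h i hi j hj).symm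

theorem IsStrictDLO.eq_iff {D : Type*} {r : D → D → Prop} (hr : IsStrictDLO r) (x y : D) :
    x = y ↔ ¬ r x y ∧ ¬ r y x := by
  constructor
  · rintro rfl
    exact ⟨hr.irrefl x, hr.irrefl x⟩
  · rintro ⟨h₁, h₂⟩
    rcases hr.total x y with h | h | h
    · exact h
    · exact absurd h h₁
    · exact absurd h h₂

theorem OrderSimilar.eq_iff {D E : Type*} {r : D → D → Prop} {q : E → E → Prop}
    (hr : IsStrictDLO r) (hq : IsStrictDLO q) {S : Finset ℕ}
    {a : ℕ → D} {b : ℕ → E} (h : OrderSimilar r q S a b) {i j : ℕ} (hi : i ∈ S) (hj : j ∈ S) :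
    a i = a j ↔ b i = b j := by
  rw [hr.eq_iff, hq.eq_iff, h i hi j hj, h j hj i hi]

/-- In a dense linear order without endpoints, finite sets with `lo < hi` can be separated. -/
theorem IsStrictDLO.exists_between_finsets {E : Type*} [Nonempty E] {q : E → E → Prop}
    (hq : IsStrictDLO q) (lo hi : Finset E) (h : ∀ x ∈ lo, ∀ y ∈ hi, q x y) :
    ∃ e, (∀ x ∈ lo, q x e) ∧ ∀ y ∈ hi, q e y := by
  classical
  have : IsStrictTotalOrder E q :=
    { irrefl := hq.irrefl
      trans := hq.trans
      trichotomous := fun x y h₁ h₂ => (hq.eq_iff x y).2 ⟨h₁, h₂⟩ }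
  let : LinearOrder E := linearOrderOfSTO q
  have : DenselyOrdered E := ⟨hq.dense⟩
  have : NoMaxOrder E := ⟨hq.noMax⟩
  have : NoMinOrder E := ⟨hq.noMin⟩
  exact Order.exists_between_finsets lo hi h

/-- The back-and-forth step: order-similar assignments can be extended by one variable. -/
theorem OrderSimilar.extend {D E : Type*} [Nonempty E] {r : D → D → Prop} {q : E → E → Prop}
    (hr : IsStrictDLO r) (hq : IsStrictDLO q) {S : Finset ℕ} {a : ℕ → D} {b : ℕ → E}
    (h : OrderSimilar r q S a b) (x : ℕ) (d : D) :
    ∃ e, OrderSimilar r q (insert x S) (Function.update a x d) (Function.update b x e) := by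
  classical
  obtain ⟨e, he⟩ : ∃ e, ∀ i ∈ S, (r (a i) d ↔ q (b i) e) ∧ (r d (a i) ↔ q e (b i)) := by
    by_cases hd : ∃ k ∈ S, a k = d
    · obtain ⟨k, hk, rfl⟩ := hd
      exact ⟨b k, fun i hi => ⟨h i hi k hk, h k hk i hi⟩⟩
    · push Not at hd
      obtain ⟨e, hlo, hhi⟩ := hq.exists_between_finsets
        ((S.filter fun i => r (a i) d).image b) ((S.filter fun i => r d (a i)).image b) (by
          simp only [Finset.mem_image, Finset.mem_filter]
          rintro _ ⟨i, ⟨hi, hid⟩, rfl⟩ _ ⟨j, ⟨hj, hdj⟩, rfl⟩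
          exact (h i hi j hj).1 (hr.trans _ _ _ hid hdj))
      refine ⟨e, fun i hi => ?_⟩
      have hlo' : r (a i) d → q (b i) e := fun hid =>
        hlo _ (Finset.mem_image_of_mem b (Finset.mem_filter.2 ⟨hi, hid⟩))
      have hhi' : r d (a i) → q e (b i) := fun hid =>
        hhi _ (Finset.mem_image_of_mem b (Finset.mem_filter.2 ⟨hi, hid⟩))
      have asymm : ¬ (q (b i) e ∧ q e (b i)) := fun hc =>
        hq.irrefl _ (hq.trans _ _ _ hc.1 hc.2)
      have tot := hr.total (a i) d
      have hne := hd i hi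
      tauto
  refine ⟨e, fun i hi j hj => ?_⟩
  have hid := hr.irrefl d
  have hie := hq.irrefl e
  rw [Finset.mem_insert] at hi hj
  by_cases hix : i = x <;> by_cases hjx : j = x
  · subst hix; subst hjx
    simp [hid, hie]
  · subst hix
    simpa [hjx] using (he j (hj.resolve_left hjx)).2
  · subst hjx
    simpa [hix] using (he i (hi.resolve_left hix)).1
  · simpa [hix, hjx] using h i (hi.resolve_left hix) j (hj.resolve_left hjx)

namespace RM.BModel

/-- The interpretation of `<` at a world. -/
def ltAt (M : BModel dloSig) (w : M.W) (x y : M.D) : Prop := M.V w () ![x, y]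

theorem truth_lt (M : BModel dloSig) (w : M.W) (a : ℕ → M.D) (i j : ℕ) :
    M.Truth w a (DLO.lt (DLO.v i) (DLO.v j)) ↔ M.ltAt w (a i) (a j) := by
  have : (fun k : Fin 2 => M.evalT a ((![DLO.v i, DLO.v j] : Fin 2 → Term dloSig) k))
      = ![a i, a j] := by
    funext k
    fin_cases k <;> rfl
  exact iff_of_eq (congrArg (M.V w ()) this)

theorem truth_rel (M : BModel dloSig) (w : M.W) (a : ℕ → M.D) (r : dloSig.Rel)
    (ts : Fin (dloSig.rarity r) → Term dloSig) :
    M.Truth w a (.rel r ts) ↔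
      M.ltAt w (M.evalT a (ts (0 : Fin 2))) (M.evalT a (ts (1 : Fin 2))) := by
  have : (fun k : Fin 2 => M.evalT a (ts k))
      = ![M.evalT a (ts (0 : Fin 2)), M.evalT a (ts (1 : Fin 2))] := by
    funext k
    fin_cases k <;> rfl
  exact iff_of_eq (congrArg (M.V w r) this)

/-- Under the `K` condition the designated world is below every world. -/
theorem Kcond.le {M : BModel dloSig} (hK : M.Kcond) (w : M.W) : M.R M.s M.s w :=
  hK _ _ _ (M.base w)

theorem SatTheory.ltAt_irrefl {M : BModel dloSig} (hT : M.SatTheory DLO.theory)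
    (w : M.W) (x : M.D) : ¬ M.ltAt w x x := fun h =>
  hT DLO.ax1 (by simp [DLO.theory]) (fun _ => x) x w w (M.base w)
    ((M.truth_lt w _ 0 0).2 (by simpa using h))

theorem SatTheory.ltAt_trans {M : BModel dloSig} (hT : M.SatTheory DLO.theory)
    (w : M.W) (x y z : M.D) (hxy : M.ltAt w x y)
    (hyz : M.ltAt w y z) : M.ltAt w x z := by
  have h := hT DLO.ax3 (by simp [DLO.theory]) (fun _ => x) x y z w w (M.base w)
    ⟨(M.truth_lt w _ 0 1).2 (by simpa using hxy), (M.truth_lt w _ 1 2).2 (by simpa using hyz)⟩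
  simpa using (M.truth_lt w _ 0 2).1 h

theorem SatTheory.ltAt_total {M : BModel dloSig} (hT : M.SatTheory DLO.theory)
    (x y : M.D) : x = y ∨ M.ltAt M.s x y ∨ M.ltAt M.s y x := by
  rcases hT DLO.ax2 (by simp [DLO.theory]) (fun _ => x) x y with h | h | h
  · left
    simpa [Truth, evalT, DLO.v] using h
  · right; left
    simpa using (M.truth_lt _ _ 0 1).1 h
  · right; right
    simpa using (M.truth_lt _ _ 1 0).1 h

theorem SatTheory.isStrictDLO {M : BModel dloSig} (hT : M.SatTheory DLO.theory) :
    IsStrictDLO (M.ltAt M.s) where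
  irrefl := SatTheory.ltAt_irrefl hT M.s
  trans := SatTheory.ltAt_trans hT M.s
  total := SatTheory.ltAt_total hT
  dense x y hxy := by
    obtain ⟨z, h₁, h₂⟩ := hT DLO.ax4 (by simp [DLO.theory]) (fun _ => x) x y M.s M.s (M.base _)
      ((M.truth_lt _ _ 0 1).2 (by simpa using hxy))
    exact ⟨z, by simpa using (M.truth_lt _ _ 0 2).1 h₁, by simpa using (M.truth_lt _ _ 2 1).1 h₂⟩
  noMax x := by
    obtain ⟨y, h⟩ := hT DLO.ax5 (by simp [DLO.theory]) (fun _ => x) x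
    exact ⟨y, by simpa using (M.truth_lt _ _ 0 1).1 h⟩
  noMin x := by
    obtain ⟨y, h⟩ := hT DLO.ax6 (by simp [DLO.theory]) (fun _ => x) x
    exact ⟨y, by simpa using (M.truth_lt _ _ 1 0).1 h⟩

/-- Under the `K` condition `<` is interpreted in the same way at every world. -/
theorem SatTheory.ltAt_iff {M : BModel dloSig} (hT : M.SatTheory DLO.theory)
    (hK : M.Kcond) (w : M.W) (x y : M.D) :
    M.ltAt w x y ↔ M.ltAt M.s x y := by
  have up : ∀ x y, M.ltAt M.s x y → M.ltAt w x y := fun x y =>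
    M.hered _ _ (Kcond.le hK w) () ![x, y]
  refine ⟨fun h => ?_, up x y⟩
  rcases SatTheory.ltAt_total hT x y with rfl | h' | h'
  · exact absurd h (SatTheory.ltAt_irrefl hT w x)
  · exact h'
  · exact absurd (SatTheory.ltAt_trans hT w _ _ _ h (up _ _ h'))
      (SatTheory.ltAt_irrefl hT w x)

/-- Order-similar assignments in two serial `K`-models of `DLO` satisfy the same formulas, at
arbitrary worlds. -/
theorem truth_iff_of_orderSimilar {M N : BModel dloSig} (hMK : M.Kcond) (hMS : M.Serial)
    (hMT : M.SatTheory DLO.theory) (hNK : N.Kcond) (hNS : N.Serial)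
    (hNT : N.SatTheory DLO.theory) (A : Formula dloSig) :
    ∀ (S : Finset ℕ), A.fv ⊆ S → ∀ (w : M.W) (w' : N.W) (a : ℕ → M.D) (b : ℕ → N.D),
      OrderSimilar (M.ltAt M.s) (N.ltAt N.s) S a b → (M.Truth w a A ↔ N.Truth w' b A) := by
  have hM := SatTheory.isStrictDLO hMT
  have hN := SatTheory.isStrictDLO hNT
  have := M.dne
  have := N.dne
  induction A with
  | falsum => intros; rfl
  | verum => intros; rfl
  | equal t u =>
    intro S hS w w' a b hab
    rcases t with i | ⟨f, _⟩
    · rcases u with j | ⟨f, _⟩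
      · exact hab.eq_iff hM hN (hS (Or.inl rfl)) (hS (Or.inr rfl))
      · exact f.elim
    · exact f.elim
  | rel r ts =>
    intro S hS w w' a b hab
    rw [truth_rel, truth_rel, SatTheory.ltAt_iff hMT hMK, SatTheory.ltAt_iff hNT hNK]
    have mem : ∀ k : Fin 2, (ts k).fv ⊆ S := fun k => (Set.subset_iUnion _ k).trans hS
    have h0 := mem 0
    have h1 := mem 1
    rcases hi : ts (0 : Fin 2) with i | ⟨f, _⟩
    · rcases hj : ts (1 : Fin 2) with j | ⟨f, _⟩
      · rw [hi] at h0
        rw [hj] at h1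
        exact hab i (h0 rfl) j (h1 rfl)
      · exact f.elim
    · exact f.elim
  | and A B ihA ihB =>
    intro S hS w w' a b hab
    exact and_congr (ihA S (fun _ h => hS (Or.inl h)) w w' a b hab)
      (ihB S (fun _ h => hS (Or.inr h)) w w' a b hab)
  | or A B ihA ihB =>
    intro S hS w w' a b hab
    exact or_congr (ihA S (fun _ h => hS (Or.inl h)) w w' a b hab)
      (ihB S (fun _ h => hS (Or.inr h)) w w' a b hab)
  | neg A ih =>
    intro S hS w w' a b hab
    exact not_congr (ih S hS _ _ a b hab)
  | imp A B ihA ihB =>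
    intro S hS w w' a b hab
    have hA := fun u u' => ihA S (fun _ h => hS (Or.inl h)) u u' a b hab
    have hB := fun u u' => ihB S (fun _ h => hS (Or.inr h)) u u' a b hab
    constructor
    · intro h v₁ v₂ _ hv
      obtain ⟨w₁, w₂, hw⟩ := hMS w
      exact (hB w₂ v₂).1 (h w₁ w₂ hw ((hA w₁ v₁).2 hv))
    · intro h w₁ w₂ _ hw
      obtain ⟨v₁, v₂, hv⟩ := hNS w'
      exact (hB w₂ v₂).2 (h v₁ v₂ hv ((hA w₁ v₁).1 hw))
  | all x A ih =>
    intro S hS w w' a b hab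
    have hS' : A.fv ⊆ ↑(insert x S) := by
      rw [Finset.coe_insert]
      exact Set.sdiff_singleton_subset_iff.1 hS
    constructor
    · intro h e
      obtain ⟨d, hd⟩ := hab.symm.extend hN hM x e
      exact (ih _ hS' w w' _ _ hd.symm).1 (h d)
    · intro h d
      obtain ⟨e, he⟩ := hab.extend hM hN x d
      exact (ih _ hS' w w' _ _ he).2 (h e)
  | ex x A ih =>
    intro S hS w w' a b hab
    have hS' : A.fv ⊆ ↑(insert x S) := by
      rw [Finset.coe_insert]
      exact Set.sdiff_singleton_subset_iff.1 hS
    constructor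
    · rintro ⟨d, h⟩
      obtain ⟨e, he⟩ := hab.extend hM hN x d
      exact ⟨e, (ih _ hS' w w' _ _ he).1 h⟩
    · rintro ⟨e, h⟩
      obtain ⟨d, hd⟩ := hab.symm.extend hN hM x e
      exact ⟨d, (ih _ hS' w w' _ _ hd.symm).2 h⟩

end RM.BModel

/-- **Negation completeness of DLO over B + K with seriality**: for every
sentence `A`, either DLO entails `A` or DLO entails `¬A`, over the class of
all `B`-models satisfying the `K` condition and seriality. -/
theorem stmt_15 (A : Formula dloSig) (hA : A.Sentence) :
    Entails (fun M : BModel dloSig => M.Kcond ∧ M.Serial) DLO.theory A ∨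
    Entails (fun M : BModel dloSig => M.Kcond ∧ M.Serial) DLO.theory (.neg A) := by
  have key : ∀ M N : BModel dloSig, M.Kcond ∧ M.Serial → N.Kcond ∧ N.Serial →
      M.SatTheory DLO.theory → N.SatTheory DLO.theory → ∀ w w' a b,
      M.Truth w a A → N.Truth w' b A := fun M N hM hN hMT hNT w w' a b =>
    (BModel.truth_iff_of_orderSimilar hM.1 hM.2 hMT hN.1 hN.2 hNT A ∅
      (by rw [show A.fv = ∅ from hA]; exact Set.empty_subset _) w w' a b (by simp [OrderSimilar])).1
  by_cases h : ∃ M : BModel dloSig, (M.Kcond ∧ M.Serial) ∧ M.SatTheory DLO.theory ∧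
      ∃ w a, M.Truth w a A
  · obtain ⟨M, hM, hMT, w, a, hw⟩ := h
    exact Or.inl fun N hN hNT b => key M N hM hN hMT hNT w N.s a b hw
  · exact Or.inr fun N hN hNT b hb => h ⟨N, hN, hNT, _, b, hb⟩
end

section
/- Quantifier elimination for DLO over B + K with seriality: let C be the class of all B-models over the signature of DLO satisfying the K condition and seriality. Then for every formula A of the language of DLO there is a quantifier-free formula B (in the same free variables) such that DLO ⊨_C A↔B. That is, DLO admits quantifier elimination over C. -/
open RM

namespace DLO

/-- The index of the variable that a term of the language of DLO consists of. -/
def varIdx : Term dloSig → ℕ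
  | .var n => n
  | .func f _ => f.elim

theorem evalT_eq (M : BModel dloSig) (a : ℕ → M.D) (t : Term dloSig) :
    M.evalT a t = a (varIdx t) := by
  cases t with
  | var n => rfl
  | func f _ => exact f.elim

theorem term_fv (t : Term dloSig) : t.fv = {varIdx t} := by
  cases t with
  | var n => rfl
  | func f _ => exact f.elim

/-- Classical (Tarskian) truth of a formula of the language of DLO. -/
def Holds {D : Type} [LT D] : (ℕ → D) → Formula dloSig → Prop
  | _, .falsum => False
  | _, .verum => True
  | a, .equal t u => a (varIdx t) = a (varIdx u)
  | a, .rel _ ts => a (varIdx (ts (0 : Fin 2))) < a (varIdx (ts (1 : Fin 2)))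
  | a, .and A B => Holds a A ∧ Holds a B
  | a, .or A B => Holds a A ∨ Holds a B
  | a, .neg A => ¬ Holds a A
  | a, .imp A B => Holds a A → Holds a B
  | a, .all x A => ∀ d : D, Holds (Function.update a x d) A
  | a, .ex x A => ∃ d : D, Holds (Function.update a x d) A

theorem truth_iff_holds (M : BModel dloSig) [LT M.D] (hM : M.Serial)
    (hV : ∀ w (x y : M.D), M.V w () ![x, y] ↔ x < y) (A : Formula dloSig) :
    ∀ (w : M.W) (a : ℕ → M.D), M.Truth w a A ↔ Holds a A := by
  induction A with
  | falsum => intro w a; rfl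
  | verum => intro w a; rfl
  | equal t u => intro w a; simp [BModel.Truth, Holds, evalT_eq]
  | rel r ts =>
    intro w a
    have h : (fun i => M.evalT a (ts i)) =
        ![a (varIdx (ts (0 : Fin 2))), a (varIdx (ts (1 : Fin 2)))] := by
      funext i
      rw [evalT_eq]
      change Fin 2 at i
      fin_cases i <;> rfl
    simp only [BModel.Truth, Holds, h]
    exact hV w _ _
  | and A B hA hB => intro w a; simp only [BModel.Truth, Holds, hA, hB]
  | or A B hA hB => intro w a; simp only [BModel.Truth, Holds, hA, hB]
  | neg A hA => intro w a; simp only [BModel.Truth, Holds, hA]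
  | imp A B hA hB =>
    intro w a
    simp only [BModel.Truth, Holds, hA, hB]
    obtain ⟨y, z, h⟩ := hM w
    exact ⟨fun H => H y z h, fun H _ _ _ => H⟩
  | all x A hA => intro w a; simp only [BModel.Truth, Holds, hA]
  | ex x A hA => intro w a; simp only [BModel.Truth, Holds, hA]

/-- Over serial models with the `K` condition, DLO forces every world to carry one and the same
dense linear order without endpoints. -/
theorem exists_linearOrder (M : BModel dloSig) (hK : M.Kcond) (hT : M.SatTheory theory) :
    ∃ _ : LinearOrder M.D, (∀ w (x y : M.D), M.V w () ![x, y] ↔ x < y) ∧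
      DenselyOrdered M.D ∧ NoMinOrder M.D ∧ NoMaxOrder M.D := by
  classical
  obtain ⟨d₀⟩ := M.dne
  have heval : ∀ (a : ℕ → M.D) (i j : ℕ),
      (fun k : Fin 2 => M.evalT a ((![v i, v j] : Fin 2 → Term dloSig) k)) = ![a i, a j] := by
    intro a i j
    funext k
    fin_cases k <;> rfl
  have hlt : ∀ w (a : ℕ → M.D) (i j : ℕ),
      M.Truth w a (lt (v i) (v j)) ↔ M.V w () ![a i, a j] := by
    intro w a i j
    rw [← heval]
    rfl
  have hle : ∀ w, M.R M.s M.s w := fun w => hK _ _ _ (M.base w)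
  have hirr : ∀ w x, ¬ M.V w () ![x, x] := by
    intro w x h
    have := hT ax1 (by simp [theory]) (fun _ => d₀) x w w (M.base w)
    exact this ((hlt _ _ _ _).2 (by simpa using h))
  have htri : ∀ x y, x = y ∨ M.V M.s () ![x, y] ∨ M.V M.s () ![y, x] := by
    intro x y
    have := hT ax2 (by simp [theory]) (fun _ => d₀) x y
    simp only [BModel.Truth, hlt] at this
    simpa [evalT_eq, v, varIdx, Function.update] using this
  have htrans : ∀ w x y z, M.V w () ![x, y] → M.V w () ![y, z] → M.V w () ![x, z] := by
    intro w x y z h1 h2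
    have := hT ax3 (by simp [theory]) (fun _ => d₀) x y z w w (M.base w)
    simp only [BModel.Truth, hlt] at this
    simpa [Function.update] using this (by simpa [Function.update] using ⟨h1, h2⟩)
  have hdense : ∀ x y, M.V M.s () ![x, y] → ∃ z, M.V M.s () ![x, z] ∧ M.V M.s () ![z, y] := by
    intro x y h
    have := hT ax4 (by simp [theory]) (fun _ => d₀) x y M.s M.s (M.base M.s)
    simp only [BModel.Truth, hlt] at this
    simpa [Function.update] using this (by simpa [Function.update] using h)
  have hmax : ∀ x, ∃ y, M.V M.s () ![x, y] := by
    intro x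
    have := hT ax5 (by simp [theory]) (fun _ => d₀) x
    simp only [BModel.Truth, hlt] at this
    simpa [Function.update] using this
  have hmin : ∀ x, ∃ y, M.V M.s () ![y, x] := by
    intro x
    have := hT ax6 (by simp [theory]) (fun _ => d₀) x
    simp only [BModel.Truth, hlt] at this
    simpa [Function.update] using this
  let r : M.D → M.D → Prop := fun x y => M.V M.s () ![x, y]
  have hr : IsStrictTotalOrder M.D r :=
    { irrefl := hirr M.s
      trans := htrans M.s
      trichotomous := fun x y h1 h2 => by
        rcases htri x y with h | h | h
        exacts [h, (h1 h).elim, (h2 h).elim] }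
  let := linearOrderOfSTO r
  refine ⟨inferInstance, ?_, ⟨hdense⟩, ⟨hmin⟩, ⟨hmax⟩⟩
  intro w x y
  change _ ↔ M.V M.s () ![x, y]
  refine ⟨fun h => ?_, M.hered _ _ (hle w) () _⟩
  rcases htri x y with rfl | h' | h'
  · exact (hirr _ _ h).elim
  · exact h'
  · exact (hirr _ _ (htrans _ _ _ _ h (M.hered _ _ (hle w) () _ h'))).elim

/-- Two assignments realise the same order type on the variables in `S`. -/
def SameType {D E : Type} [LT D] [LT E] (S : Set ℕ) (a : ℕ → D) (b : ℕ → E) : Prop :=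
  ∀ i ∈ S, ∀ j ∈ S, a i < a j ↔ b i < b j

section

variable {D E : Type} [LinearOrder D] [LinearOrder E]

theorem SameType.symm {S : Set ℕ} {a : ℕ → D} {b : ℕ → E} (h : SameType S a b) :
    SameType S b a := fun i hi j hj => (h i hi j hj).symm

theorem SameType.mono {S T : Set ℕ} {a : ℕ → D} {b : ℕ → E} (h : SameType T a b) (hST : S ⊆ T) :
    SameType S a b := fun i hi j hj => h i (hST hi) j (hST hj)

theorem SameType.eq_iff {S : Set ℕ} {a : ℕ → D} {b : ℕ → E} (h : SameType S a b) {i j : ℕ}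
    (hi : i ∈ S) (hj : j ∈ S) : a i = a j ↔ b i = b j := by
  have h1 := h i hi j hj
  have h2 := h j hj i hi
  constructor <;> intro H <;> apply le_antisymm <;> simp_all [← not_lt]

theorem SameType.exists_update [DenselyOrdered E] [NoMinOrder E] [NoMaxOrder E] [Nonempty E]
    {S : Set ℕ} (hS : S.Finite) {x : ℕ} {a : ℕ → D} {b : ℕ → E} (h : SameType (S \ {x}) a b)
    (d : D) : ∃ e : E, SameType S (Function.update a x d) (Function.update b x e) := by
  classical
  suffices H : ∃ e : E, ∀ i ∈ S \ {x}, (a i < d ↔ b i < e) ∧ (d < a i ↔ e < b i) by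
    obtain ⟨e, he⟩ := H
    refine ⟨e, fun i hi j hj => ?_⟩
    by_cases hix : i = x <;> by_cases hjx : j = x
    · simp [hix, hjx]
    · subst hix
      simpa [hjx] using (he j ⟨hj, hjx⟩).2
    · subst hjx
      simpa [hix] using (he i ⟨hi, hix⟩).1
    · simpa [hix, hjx] using h i ⟨hi, hix⟩ j ⟨hj, hjx⟩
  by_cases hd : ∃ k ∈ S \ {x}, a k = d
  · obtain ⟨k, hk, rfl⟩ := hd
    exact ⟨b k, fun i hi => ⟨h i hi k hk, h k hk i hi⟩⟩
  · push Not at hd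
    let F : Finset ℕ := (hS.subset Set.sdiff_subset : (S \ {x}).Finite).toFinset
    have hF : ∀ i, i ∈ F ↔ i ∈ S \ {x} := fun i => Set.Finite.mem_toFinset _
    obtain ⟨e, hlo, hhi⟩ := Order.exists_between_finsets
      ((F.filter fun i => a i < d).image b) ((F.filter fun i => d < a i).image b) (by
        simp only [Finset.mem_image, Finset.mem_filter, hF]
        rintro _ ⟨i, ⟨hi, hid⟩, rfl⟩ _ ⟨j, ⟨hj, hjd⟩, rfl⟩
        exact (h i hi j hj).1 (hid.trans hjd))
    refine ⟨e, fun i hi => ?_⟩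
    rcases lt_or_gt_of_ne (hd i hi) with hlt | hgt
    · have := hlo (b i) (Finset.mem_image_of_mem b (Finset.mem_filter.2 ⟨(hF i).2 hi, hlt⟩))
      simp [hlt, this, hlt.not_gt, this.not_gt]
    · have := hhi (b i) (Finset.mem_image_of_mem b (Finset.mem_filter.2 ⟨(hF i).2 hi, hgt⟩))
      simp [hgt, this, hgt.not_gt, this.not_gt]

end

theorem fv_finite (A : Formula dloSig) : A.fv.Finite := by
  induction A with
  | falsum => exact Set.finite_empty
  | verum => exact Set.finite_empty
  | equal t u => simp [Formula.fv, term_fv]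
  | rel r ts => exact Set.finite_iUnion fun i => by simp [term_fv]
  | and A B hA hB => exact hA.union hB
  | or A B hA hB => exact hA.union hB
  | neg A hA => exact hA
  | imp A B hA hB => exact hA.union hB
  | all x A hA => exact hA.subset Set.sdiff_subset
  | ex x A hA => exact hA.subset Set.sdiff_subset

/-- In dense linear orders without endpoints, truth of a formula depends only on the order type of
its free variables. -/
theorem SameType.holds_iff {D E : Type} [LinearOrder D] [LinearOrder E]
    [DenselyOrdered D] [NoMinOrder D] [NoMaxOrder D] [Nonempty D]
    [DenselyOrdered E] [NoMinOrder E] [NoMaxOrder E] [Nonempty E] (A : Formula dloSig) :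
    ∀ {a : ℕ → D} {b : ℕ → E}, SameType A.fv a b → (Holds a A ↔ Holds b A) := by
  induction A with
  | falsum => intro a b _; rfl
  | verum => intro a b _; rfl
  | equal t u =>
    intro a b h
    exact h.eq_iff (by simp [Formula.fv, term_fv]) (by simp [Formula.fv, term_fv])
  | rel r ts =>
    intro a b h
    have hmem : ∀ i : Fin 2, varIdx (ts i) ∈ (Formula.rel r ts).fv := fun i =>
      Set.mem_iUnion.2 ⟨i, by simp [term_fv]⟩
    exact h _ (hmem 0) _ (hmem 1)
  | and A B hA hB =>
    intro a b h
    exact and_congr (hA (h.mono Set.subset_union_left)) (hB (h.mono Set.subset_union_right))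
  | or A B hA hB =>
    intro a b h
    exact or_congr (hA (h.mono Set.subset_union_left)) (hB (h.mono Set.subset_union_right))
  | neg A hA => intro a b h; exact not_congr (hA h)
  | imp A B hA hB =>
    intro a b h
    exact imp_congr (hA (h.mono Set.subset_union_left)) (hB (h.mono Set.subset_union_right))
  | all x A hA =>
    intro a b h
    constructor
    · intro H e
      obtain ⟨d, hd⟩ := SameType.exists_update (fv_finite A) h.symm e
      exact (hA hd.symm).1 (H d)
    · intro H d
      obtain ⟨e, he⟩ := SameType.exists_update (fv_finite A) h d
      exact (hA he).2 (H e)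
  | ex x A hA =>
    intro a b h
    constructor
    · rintro ⟨d, hd⟩
      obtain ⟨e, he⟩ := SameType.exists_update (fv_finite A) h d
      exact ⟨e, (hA he).1 hd⟩
    · rintro ⟨e, he⟩
      obtain ⟨d, hd⟩ := SameType.exists_update (fv_finite A) h.symm e
      exact ⟨d, (hA hd.symm).2 he⟩

/-- The property `P` of assignments into linear orders is uniformly defined by a quantifier-free
formula with free variables in `S`. -/
def QFDefinable (S : Set ℕ) (P : ∀ (D : Type) [LinearOrder D], (ℕ → D) → Prop) : Prop :=
  ∃ B : Formula dloSig, B.QFree ∧ B.fv ⊆ S ∧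
    ∀ (D : Type) [LinearOrder D] (a : ℕ → D), Holds a B ↔ P D a

theorem qfDefinable_lt {S : Set ℕ} {i j : ℕ} (hi : i ∈ S) (hj : j ∈ S) :
    QFDefinable S fun _ _ a => a i < a j := by
  refine ⟨lt (v i) (v j), trivial, ?_, fun _ _ _ => Iff.rfl⟩
  refine Set.iUnion_subset fun k => ?_
  change Fin 2 at k
  fin_cases k <;> simpa [v, Term.fv]

theorem QFDefinable.neg {S : Set ℕ} {P : ∀ (D : Type) [LinearOrder D], (ℕ → D) → Prop}
    (h : QFDefinable S P) : QFDefinable S fun D _ a => ¬ P D a := by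
  obtain ⟨B, hB, hfv, h⟩ := h
  exact ⟨.neg B, hB, hfv, fun D _ a => not_congr (h D a)⟩

theorem QFDefinable.forall_mem {ι : Type*} {S : Set ℕ} (s : Finset ι)
    {P : ι → ∀ (D : Type) [LinearOrder D], (ℕ → D) → Prop} (h : ∀ i ∈ s, QFDefinable S (P i)) :
    QFDefinable S fun D _ a => ∀ i ∈ s, P i D a := by
  classical
  induction s using Finset.induction_on with
  | empty => exact ⟨.verum, trivial, Set.empty_subset _, fun D _ a => by simp [Holds]⟩
  | insert i s _ ih =>
    obtain ⟨B, hB, hBfv, hBP⟩ := h i (Finset.mem_insert_self i s)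
    obtain ⟨C, hC, hCfv, hCP⟩ := ih fun j hj => h j (Finset.mem_insert_of_mem hj)
    exact ⟨.and B C, ⟨hB, hC⟩, Set.union_subset hBfv hCfv, fun D _ a => by
      simp [Holds, hBP, hCP]⟩

theorem QFDefinable.exists_mem {ι : Type*} {S : Set ℕ} (s : Finset ι)
    {P : ι → ∀ (D : Type) [LinearOrder D], (ℕ → D) → Prop} (h : ∀ i ∈ s, QFDefinable S (P i)) :
    QFDefinable S fun D _ a => ∃ i ∈ s, P i D a := by
  simpa using (QFDefinable.forall_mem s fun i hi => (h i hi).neg).neg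

/-- Quantifier elimination for DLO in classical first-order logic. -/
theorem exists_qfree_holds_iff (A : Formula dloSig) :
    ∃ B : Formula dloSig, B.QFree ∧ B.fv ⊆ A.fv ∧
      ∀ (D : Type) [LinearOrder D] [DenselyOrdered D] [NoMinOrder D] [NoMaxOrder D] [Nonempty D]
        (a : ℕ → D), Holds a A ↔ Holds a B := by
  classical
  let F : Finset ℕ := (fv_finite A).toFinset
  have hF : ∀ i, i ∈ F ↔ i ∈ A.fv := fun i => Set.Finite.mem_toFinset _
  let realizes (p : Finset (ℕ × ℕ)) (D : Type) [LinearOrder D] (a : ℕ → D) : Prop :=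
    ∀ q ∈ F ×ˢ F, a q.1 < a q.2 ↔ q ∈ p
  let good (p : Finset (ℕ × ℕ)) : Prop :=
    ∃ (D : Type) (_ : LinearOrder D) (_ : DenselyOrdered D) (_ : NoMinOrder D) (_ : NoMaxOrder D)
      (_ : Nonempty D) (a : ℕ → D), realizes p D a ∧ Holds a A
  have hdef : QFDefinable A.fv fun D _ a =>
      ∃ p ∈ (F ×ˢ F).powerset.filter good, realizes p D a := by
    refine QFDefinable.exists_mem _ fun p _ => QFDefinable.forall_mem _ fun q hq => ?_
    have hq' := Finset.mem_product.1 hq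
    have h := qfDefinable_lt ((hF _).1 hq'.1) ((hF _).1 hq'.2)
    by_cases hp : q ∈ p
    · simpa [hp] using h
    · simpa only [hp, iff_false] using h.neg
  obtain ⟨B, hB, hfv, h⟩ := hdef
  refine ⟨B, hB, hfv, fun D _ _ _ _ _ a => ?_⟩
  rw [h]
  constructor
  · intro hA
    have hreal : realizes ((F ×ˢ F).filter fun q => a q.1 < a q.2) D a := fun q hq => by
      rw [Finset.mem_filter, and_iff_right hq]
    exact ⟨_, Finset.mem_filter.2 ⟨Finset.mem_powerset.2 (Finset.filter_subset _ _),
      D, ‹_›, ‹_›, ‹_›, ‹_›, ‹_›, a, hreal, hA⟩, hreal⟩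
  · rintro ⟨p, hp, ha⟩
    obtain ⟨E, _, _, _, _, _, b, hb, hbA⟩ := (Finset.mem_filter.1 hp).2
    have hab : SameType A.fv a b := fun i hi j hj =>
      have hij : (i, j) ∈ F ×ˢ F := Finset.mem_product.2 ⟨(hF i).2 hi, (hF j).2 hj⟩
      (ha _ hij).trans (hb _ hij).symm
    exact (SameType.holds_iff A hab).2 hbA

end DLO

/-- **Quantifier elimination for DLO over B + K with seriality**: every
formula is DLO-equivalent, over the class of all `B`-models satisfying the `K`
condition and seriality, to a quantifier-free formula in the same free
variables. -/
theorem stmt_16 (A : Formula dloSig) :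
    ∃ B : Formula dloSig, B.QFree ∧ B.fv ⊆ A.fv ∧
      Entails (fun M : BModel dloSig => M.Kcond ∧ M.Serial) DLO.theory (A.iff B) := by
  obtain ⟨B, hB, hfv, h⟩ := DLO.exists_qfree_holds_iff A
  refine ⟨B, hB, hfv, ?_⟩
  rintro M ⟨hK, hS⟩ hT a
  obtain ⟨_, hV, _, _, _⟩ := DLO.exists_linearOrder M hK hT
  have := M.dne
  rw [DLO.truth_iff_holds M hS hV]
  exact ⟨(h M.D a).1, (h M.D a).2⟩
end
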